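/- arXiv:math/0010196 — 4 statements merged into one kernel-verified Lean document; each statement's English description precedes it below -/
import Mathlib

section
/- Let φ¹, φ², f be Schwartz functions on ℝ, and define ψ(x) := ∫_{-∞}^{∞} conj(φ¹(y)) φ²(x + y) dy. Then for every x ∈ ℝ, ∫_0^1 Σ_{n∈ℤ} ⟨f, τ_{n+y} φ¹⟩ · (τ_{n+y} φ²)(x) dy = (f ∗ ψ)(x), and moreover 𝓕ψ(ξ) = conj(𝓕φ¹(ξ)) · 𝓕φ²(ξ) for all ξ ∈ ℝ. -/
open MeasureTheory Filter
open scoped ENNReal Topology ComplexConjugate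

noncomputable section

/-- The Fourier transform `𝓕 g (ξ) = ∫ e^{-i x ξ} g x dx` on the line. -/
def FT1 (g : ℝ → ℂ) (ξ : ℝ) : ℂ := ∫ x : ℝ, Complex.exp (-(Complex.I * x * ξ)) * g x

/-- Unfolding: averaging the sum over integer translates recovers the integral over the line. -/
lemma intervalIntegral_tsum_int_add {G : ℝ → ℂ} (hG : Integrable G) :
    ∫ y in (0:ℝ)..1, ∑' n : ℤ, G (n + y) = ∫ s, G s := by
  have hcomm : ∀ (n : ℤ) (y : ℝ), G (n + y) = G (y + n) := fun n y => by rw [add_comm]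
  simp_rw [hcomm]
  rw [← hG.hasSum_intervalIntegral_comp_add_int.tsum_eq]
  have hnorm := hG.norm.hasSum_intervalIntegral_comp_add_int.summable
  simp_rw [intervalIntegral.integral_of_le zero_le_one] at hnorm ⊢
  exact (integral_tsum_of_summable_integral_norm
    (fun n : ℤ => (hG.comp_add_right (n : ℝ)).integrableOn) hnorm).symm

/-- The integrand of the synthesis formula is jointly integrable in the translation parameter and
the variable of `f`. -/
lemma integrable_translate_kernel (φ₁ φ₂ f : SchwartzMap ℝ ℂ) (x : ℝ) :
    Integrable (fun p : ℝ × ℝ => f p.2 * conj (φ₁ (p.2 - p.1)) * φ₂ (x - p.1))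
      (volume.prod volume) := by
  have h : Integrable (fun p : ℝ × ℝ => φ₂ (x - p.1) * f p.2) (volume.prod volume) :=
    (φ₂.integrable.comp_sub_left x).mul_prod f.integrable
  obtain ⟨C, -, hC⟩ := φ₁.decay 0 0
  have hcont : Continuous fun p : ℝ × ℝ => conj (φ₁ (p.2 - p.1)) :=
    Complex.continuous_conj.comp (φ₁.continuous.comp (by fun_prop))
  refine (h.bdd_mul (c := C) hcont.aestronglyMeasurable
    (.of_forall fun p => ?_)).congr (.of_forall fun p => ?_)
  · simpa using hC (p.2 - p.1)
  · ring

lemma integral_correlation_eq (φ₁ φ₂ : SchwartzMap ℝ ℂ) (x t : ℝ) :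
    ∫ s : ℝ, conj (φ₁ (t - s)) * φ₂ (x - s) = ∫ y : ℝ, conj (φ₁ y) * φ₂ (x - t + y) := by
  rw [← integral_sub_left_eq_self (fun y => conj (φ₁ y) * φ₂ (x - t + y)) volume t]
  simp_rw [sub_add_sub_cancel]

lemma integrable_conj_mul_add (φ₁ φ₂ : SchwartzMap ℝ ℂ) :
    Integrable (fun p : ℝ × ℝ => conj (φ₁ p.2) * φ₂ (p.1 + p.2)) (volume.prod volume) := by
  have h₁ : Integrable fun y => conj (φ₁ y) := φ₁.integrable.norm.mono'
    (Complex.continuous_conj.comp φ₁.continuous).aestronglyMeasurable (.of_forall fun y => by simp)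
  have h : Integrable (fun p : ℝ × ℝ => φ₂ p.1 * conj (φ₁ p.2)) (volume.prod volume) :=
    φ₂.integrable.mul_prod h₁
  have hmp : MeasurePreserving (fun p : ℝ × ℝ => (p.1 + p.2, p.2)) (volume.prod volume)
      (volume.prod volume) := measurePreserving_add_prod volume volume
  exact (hmp.integrable_comp_of_integrable h).congr (.of_forall fun p => mul_comm _ _)

lemma norm_exp_neg_I_mul (x ξ : ℝ) : ‖Complex.exp (-(Complex.I * x * ξ))‖ = 1 := by
  simp [Complex.norm_exp]

lemma FT1_comp_add_right (g : ℝ → ℂ) (ξ y : ℝ) :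
    ∫ x : ℝ, Complex.exp (-(Complex.I * x * ξ)) * g (x + y)
      = Complex.exp (Complex.I * y * ξ) * FT1 g ξ := by
  rw [FT1, ← integral_const_mul,
    ← integral_add_right_eq_self
      (fun x : ℝ => Complex.exp (Complex.I * y * ξ) * (Complex.exp (-(Complex.I * x * ξ)) * g x)) y]
  congr 1 with x
  rw [← mul_assoc, ← Complex.exp_add]
  congr 2
  push_cast
  ring

lemma conj_FT1 (g : ℝ → ℂ) (ξ : ℝ) :
    conj (FT1 g ξ) = ∫ y : ℝ, Complex.exp (Complex.I * y * ξ) * conj (g y) := by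
  rw [FT1, ← integral_conj]
  congr 1 with y
  simp [← Complex.exp_conj]

lemma FT1_correlation (φ₁ φ₂ : SchwartzMap ℝ ℂ) (ξ : ℝ) :
    FT1 (fun x => ∫ y : ℝ, conj (φ₁ y) * φ₂ (x + y)) ξ
      = conj (FT1 (⇑φ₁) ξ) * FT1 (⇑φ₂) ξ := by
  have hint : Integrable (fun p : ℝ × ℝ => Complex.exp (-(Complex.I * p.1 * ξ)) *
      (conj (φ₁ p.2) * φ₂ (p.1 + p.2))) (volume.prod volume) :=
    (integrable_conj_mul_add φ₁ φ₂).bdd_mul (c := 1)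
      (by fun_prop) (.of_forall fun p => (norm_exp_neg_I_mul _ _).le)
  rw [conj_FT1, ← integral_mul_const, FT1]
  simp_rw [← integral_const_mul]
  rw [integral_integral_swap hint]
  congr 1 with y
  simp_rw [mul_left_comm _ (conj (φ₁ y))]
  rw [integral_const_mul, FT1_comp_add_right]
  ring

/-- For Schwartz `φ¹, φ², f` on the line, with `ψ(x) = ∫ conj (φ¹ y) φ² (x + y) dy`, the averaged
sum of rank-one operators `∫₀¹ Σ_n ⟨f, τ_{n+y} φ¹⟩ τ_{n+y} φ² (x) dy` equals `f ∗ ψ (x)`, and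
`𝓕ψ = conj (𝓕φ¹) ⬝ 𝓕φ²`. -/
theorem averaged_translates_eq_convolution
    (φ₁ φ₂ f : SchwartzMap ℝ ℂ) (ψ : ℝ → ℂ)
    (hψ : ∀ x : ℝ, ψ x = ∫ y : ℝ, conj (φ₁ y) * φ₂ (x + y)) :
    (∀ x : ℝ,
      (∫ y in (0:ℝ)..1, ∑' n : ℤ,
          (∫ t : ℝ, f t * conj (φ₁ (t - ((n : ℝ) + y)))) * φ₂ (x - ((n : ℝ) + y)))
        = ∫ t : ℝ, f t * ψ (x - t)) ∧
    (∀ ξ : ℝ, FT1 ψ ξ = conj (FT1 (⇑φ₁) ξ) * FT1 (⇑φ₂) ξ) := by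
  obtain rfl : ψ = fun x => ∫ y : ℝ, conj (φ₁ y) * φ₂ (x + y) := funext hψ
  refine ⟨fun x => ?_, FT1_correlation φ₁ φ₂⟩
  have hint := integrable_translate_kernel φ₁ φ₂ f x
  have hG : Integrable fun s : ℝ => (∫ t : ℝ, f t * conj (φ₁ (t - s))) * φ₂ (x - s) := by
    simpa only [integral_mul_const] using hint.integral_prod_left
  rw [intervalIntegral_tsum_int_add hG]
  simp_rw [← integral_mul_const]
  rw [integral_integral_swap hint]
  congr 1 with t
  simp_rw [mul_assoc]
  rw [integral_const_mul, integral_correlation_eq]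

end
end

section
/- Let a > 0 and let R = r₁ × r₂ be a dyadic rectangle. If |r₂| ≤ (a/3)|r₁| then P_{(−1,a)} φ¹_R = φ¹_R, while if |r₂| ≥ 3a|r₁| then P_{(−1,a)} φ¹_R = 0. -/
open MeasureTheory Filter
open scoped ENNReal Topology ComplexConjugate

noncomputable section

/-- A dyadic interval `[m 2^n, (m+1) 2^n)` is encoded by the pair `(m, n) : ℤ × ℤ`. -/
abbrev DyadicIntvl := ℤ × ℤ

/-- The length `2^n` of a dyadic interval. -/
def dLen (I : DyadicIntvl) : ℝ := (2 : ℝ) ^ I.2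

/-- The center of a dyadic interval. -/
def dCtr (I : DyadicIntvl) : ℝ := ((I.1 : ℝ) + 1 / 2) * (2 : ℝ) ^ I.2

/-- The underlying set of a dyadic interval. -/
def dSet (I : DyadicIntvl) : Set ℝ :=
  Set.Ico ((I.1 : ℝ) * (2 : ℝ) ^ I.2) (((I.1 : ℝ) + 1) * (2 : ℝ) ^ I.2)

/-- A dyadic rectangle is a product of two dyadic intervals. -/
abbrev DyadicRect := DyadicIntvl × DyadicIntvl

/-- The underlying set of a dyadic rectangle. -/
def rSet (R : DyadicRect) : Set (ℝ × ℝ) := dSet R.1 ×ˢ dSet R.2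

/-- The area `|R|` of a dyadic rectangle. -/
def rArea (R : DyadicRect) : ℝ := dLen R.1 * dLen R.2

/-- The center of a dyadic rectangle. -/
def rCtr (R : DyadicRect) : ℝ × ℝ := (dCtr R.1, dCtr R.2)

/-- `⟨f, g⟩ = ∫ f conj g` for functions on the plane. -/
def pair2 (f g : ℝ × ℝ → ℂ) : ℂ := ∫ x, f x * conj (g x)

/-- The Fourier transform on the plane. -/
def FT2 (f : ℝ × ℝ → ℂ) (ξ : ℝ × ℝ) : ℂ :=
  ∫ x : ℝ × ℝ, Complex.exp (-(Complex.I * (x.1 * ξ.1 + x.2 * ξ.2))) * f x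

/-- The Fourier projection `P_v` onto frequencies `ξ` with `ξ ⬝ v > 0`, written as an explicit
Fourier inversion integral; on functions with integrable, compactly supported Fourier transform
(such as the wave packets `φ¹_R`) this is the smooth representative of the `L²` multiplier
operator with symbol `1_{ξ ⬝ v > 0}`. -/
def Pdir (v : ℝ × ℝ) (f : ℝ × ℝ → ℂ) (x : ℝ × ℝ) : ℂ :=
  ((((2 * Real.pi) ^ 2 : ℝ) : ℂ))⁻¹ *
    ∫ ξ : ℝ × ℝ, Set.indicator {ξ : ℝ × ℝ | 0 < ξ.1 * v.1 + ξ.2 * v.2}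
      (fun ξ => FT2 f ξ * Complex.exp (Complex.I * (x.1 * ξ.1 + x.2 * ξ.2))) ξ

/-- The `L²`-normalized wave packet adapted to the rectangle with centers `c₁, c₂` and
side lengths `l₁, l₂`, built from a profile `φ` of one variable. -/
def waveG (φ : ℝ → ℂ) (c₁ l₁ c₂ l₂ : ℝ) (x : ℝ × ℝ) : ℂ :=
  (((Real.sqrt l₁)⁻¹ * (Real.sqrt l₂)⁻¹ : ℝ) : ℂ) *
    (φ ((x.1 - c₁) / l₁) * φ ((x.2 - c₂) / l₂))

/-- The wave packet `φ_R` adapted to a dyadic rectangle `R`. -/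
def wave (φ : ℝ → ℂ) (R : DyadicRect) : ℝ × ℝ → ℂ :=
  waveG φ (dCtr R.1) (dLen R.1) (dCtr R.2) (dLen R.2)

/-- The standing hypotheses on the profile `φ¹`:  `1_{[7/8,13/8]} ≤ 𝓕φ¹ ≤ 1_{[3/4,7/4]}`
(in particular `𝓕φ¹` is real-valued). -/
def Phi1Hyp (φ : ℝ → ℂ) : Prop :=
  ∀ ξ : ℝ, (Set.indicator (Set.Icc (7/8 : ℝ) (13/8)) (fun _ => (1:ℝ)) ξ ≤ (FT1 φ ξ).re ∧
    (FT1 φ ξ).re ≤ Set.indicator (Set.Icc (3/4 : ℝ) (7/4)) (fun _ => (1:ℝ)) ξ) ∧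
    (FT1 φ ξ).im = 0

lemma FT1_eq_fourier (g : ℝ → ℂ) (ξ : ℝ) :
    FT1 g ξ = FourierTransform.fourier g (ξ / (2 * Real.pi)) := by
  rw [Real.fourier_real_eq_integral_exp_smul, FT1]
  refine integral_congr_ae (Eventually.of_forall fun x => ?_)
  have hpi : (Real.pi : ℂ) ≠ 0 := by exact_mod_cast Real.pi_ne_zero
  simp only [smul_eq_mul]
  congr 2
  push_cast
  field_simp

/-- Fourier inversion for Schwartz functions on the line, in the normalization of `FT1`. -/
lemma integral_FT1_mul_exp (φ : SchwartzMap ℝ ℂ) (y : ℝ) :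
    ∫ ξ : ℝ, FT1 (⇑φ) ξ * Complex.exp (Complex.I * (y * ξ)) = 2 * Real.pi * φ y := by
  have hinv : FourierTransformInv.fourierInv (FourierTransform.fourier (⇑φ)) y = φ y := by
    rw [← SchwartzMap.fourier_coe, ← SchwartzMap.fourierInv_coe,
      FourierTransform.fourierInv_fourier_eq]
  have hpi : (Real.pi : ℂ) ≠ 0 := by exact_mod_cast Real.pi_ne_zero
  have h := Measure.integral_comp_div (fun v : ℝ => FourierTransform.fourier (⇑φ) v *
    Complex.exp (Complex.I * (y * (2 * Real.pi * v)))) (2 * Real.pi)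
  rw [abs_of_pos Real.two_pi_pos] at h
  rw [← hinv, Real.fourierInv_eq']
  calc _ = _ := ?_
    _ = _ := h
    _ = _ := ?_
  · refine integral_congr_ae (Eventually.of_forall fun x => ?_)
    simp only [FT1_eq_fourier]
    congr 2
    push_cast
    field_simp
  · rw [Complex.real_smul]
    push_cast
    congr 1
    refine integral_congr_ae (Eventually.of_forall fun x => ?_)
    simp only [smul_eq_mul, RCLike.inner_apply, conj_trivial]
    rw [mul_comm]
    congr 2
    push_cast
    ring

lemma FT1_const_mul_comp_sub_div (φ : ℝ → ℂ) (b : ℂ) (c : ℝ) {l : ℝ} (hl : 0 < l) (ξ : ℝ) :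
    FT1 (fun x => b * φ ((x - c) / l)) ξ =
      b * l * Complex.exp (-(Complex.I * (c * ξ))) * FT1 φ (l * ξ) := by
  have hl' : (l : ℂ) ≠ 0 := by exact_mod_cast hl.ne'
  have h1 := integral_sub_right_eq_self (μ := volume) (fun x : ℝ =>
    Complex.exp (-(Complex.I * ((x + c : ℝ) : ℂ) * ξ)) * (b * φ (x / l))) c
  have h2 := Measure.integral_comp_div (fun x : ℝ =>
    Complex.exp (-(Complex.I * ((l * x + c : ℝ) : ℂ) * ξ)) * (b * φ x)) l
  simp only [sub_add_cancel] at h1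
  simp only [mul_div_cancel₀ _ hl.ne'] at h2
  rw [FT1, h1, h2, abs_of_pos hl, Complex.real_smul, FT1, ← integral_const_mul,
    ← integral_const_mul]
  refine integral_congr_ae (Eventually.of_forall fun x => ?_)
  have he : Complex.exp (-(Complex.I * ((l * x + c : ℝ) : ℂ) * ξ)) =
      Complex.exp (-(Complex.I * (c * ξ))) * Complex.exp (-(Complex.I * x * (l * ξ : ℝ))) := by
    rw [← Complex.exp_add]
    congr 1
    push_cast
    ring
  simp only [he]
  ring

lemma integral_FT1_const_mul_comp_sub_div_mul_exp (φ : SchwartzMap ℝ ℂ) (b : ℂ) (c : ℝ) {l : ℝ}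
    (hl : 0 < l) (x : ℝ) :
    ∫ ξ : ℝ, FT1 (fun x => b * φ ((x - c) / l)) ξ * Complex.exp (Complex.I * (x * ξ)) =
      2 * Real.pi * (b * φ ((x - c) / l)) := by
  have hl' : (l : ℂ) ≠ 0 := by exact_mod_cast hl.ne'
  have h := Measure.integral_comp_mul_left (fun ξ : ℝ => FT1 (⇑φ) ξ *
    Complex.exp (Complex.I * (((x - c) / l : ℝ) * ξ))) l
  rw [integral_FT1_mul_exp, abs_of_pos (inv_pos.2 hl), Complex.real_smul] at h
  calc _ = ∫ ξ : ℝ, (b * l) * (FT1 (⇑φ) (l * ξ) *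
        Complex.exp (Complex.I * (((x - c) / l : ℝ) * (l * ξ : ℝ)))) := ?_
    _ = _ := by
      rw [integral_const_mul, h]
      push_cast
      field_simp
  refine integral_congr_ae (Eventually.of_forall fun ξ => ?_)
  have he : Complex.exp (Complex.I * (((x - c) / l : ℝ) * (l * ξ : ℝ))) =
      Complex.exp (-(Complex.I * (c * ξ))) * Complex.exp (Complex.I * (x * ξ)) := by
    rw [← Complex.exp_add]
    congr 1
    push_cast
    field_simp
    ring
  simp only [he, FT1_const_mul_comp_sub_div _ b c hl]
  ring

lemma FT2_mul (f g : ℝ → ℂ) (ξ : ℝ × ℝ) :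
    FT2 (fun x => f x.1 * g x.2) ξ = FT1 f ξ.1 * FT1 g ξ.2 := by
  rw [FT2, FT1, FT1, ← integral_prod_mul, ← Measure.volume_eq_prod]
  refine integral_congr_ae (Eventually.of_forall fun x => ?_)
  have he : Complex.exp (-(Complex.I * (x.1 * ξ.1 + x.2 * ξ.2))) =
      Complex.exp (-(Complex.I * x.1 * ξ.1)) * Complex.exp (-(Complex.I * x.2 * ξ.2)) := by
    rw [← Complex.exp_add]
    congr 1
    ring
  simp only [he]
  ring

lemma waveG_eq_mul (φ : ℝ → ℂ) (c₁ l₁ c₂ l₂ : ℝ) :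
    waveG φ c₁ l₁ c₂ l₂ = fun x => (((Real.sqrt l₁)⁻¹ : ℝ) * φ ((x.1 - c₁) / l₁)) *
      (((Real.sqrt l₂)⁻¹ : ℝ) * φ ((x.2 - c₂) / l₂)) := by
  funext x
  rw [waveG]
  push_cast
  ring

lemma FT1_eq_zero_of_notMem {φ : ℝ → ℂ} (hφ : Phi1Hyp φ) {ξ : ℝ}
    (hξ : ξ ∉ Set.Icc (3 / 4 : ℝ) (7 / 4)) : FT1 φ ξ = 0 := by
  obtain ⟨⟨hlow, hup⟩, him⟩ := hφ ξ
  rw [Set.indicator_of_notMem hξ] at hup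
  have hnonneg : (0 : ℝ) ≤ Set.indicator (Set.Icc (7/8 : ℝ) (13/8)) (fun _ => (1:ℝ)) ξ :=
    Set.indicator_nonneg (fun _ _ => zero_le_one) _
  exact Complex.ext (le_antisymm hup (hnonneg.trans hlow)) him

/-- The frequency support of a wave packet is contained in the dual rectangle. -/
lemma mem_Icc_of_FT2_waveG_ne_zero {φ : ℝ → ℂ} (hφ : Phi1Hyp φ) (c₁ c₂ : ℝ) {l₁ l₂ : ℝ}
    (hl₁ : 0 < l₁) (hl₂ : 0 < l₂) {ξ : ℝ × ℝ} (hξ : FT2 (waveG φ c₁ l₁ c₂ l₂) ξ ≠ 0) :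
    l₁ * ξ.1 ∈ Set.Icc (3 / 4 : ℝ) (7 / 4) ∧ l₂ * ξ.2 ∈ Set.Icc (3 / 4 : ℝ) (7 / 4) := by
  rw [waveG_eq_mul, FT2_mul (fun x => ((Real.sqrt l₁)⁻¹ : ℝ) * φ ((x - c₁) / l₁))
    (fun x => ((Real.sqrt l₂)⁻¹ : ℝ) * φ ((x - c₂) / l₂)),
    FT1_const_mul_comp_sub_div _ _ _ hl₁, FT1_const_mul_comp_sub_div _ _ _ hl₂] at hξ
  constructor <;> by_contra h <;> exact hξ (by simp [FT1_eq_zero_of_notMem hφ h])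

/-- Fourier inversion on the plane for wave packets. -/
lemma integral_FT2_waveG_mul_exp (φ : SchwartzMap ℝ ℂ) (c₁ c₂ : ℝ) {l₁ l₂ : ℝ}
    (hl₁ : 0 < l₁) (hl₂ : 0 < l₂) (x : ℝ × ℝ) :
    ∫ ξ : ℝ × ℝ, FT2 (waveG φ c₁ l₁ c₂ l₂) ξ *
        Complex.exp (Complex.I * (x.1 * ξ.1 + x.2 * ξ.2)) =
      ((2 * Real.pi) ^ 2 : ℝ) * waveG φ c₁ l₁ c₂ l₂ x := by
  have h := integral_prod_mul (μ := (volume : Measure ℝ)) (ν := (volume : Measure ℝ))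
    (fun ξ => FT1 (fun x => ((Real.sqrt l₁)⁻¹ : ℝ) * φ ((x - c₁) / l₁)) ξ *
      Complex.exp (Complex.I * (x.1 * ξ)))
    (fun ξ => FT1 (fun x => ((Real.sqrt l₂)⁻¹ : ℝ) * φ ((x - c₂) / l₂)) ξ *
      Complex.exp (Complex.I * (x.2 * ξ)))
  rw [integral_FT1_const_mul_comp_sub_div_mul_exp _ _ _ hl₁,
    integral_FT1_const_mul_comp_sub_div_mul_exp _ _ _ hl₂, ← Measure.volume_eq_prod] at h
  simp only [waveG_eq_mul]
  calc _ = _ := ?_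
    _ = _ := h
    _ = _ := by
      push_cast
      ring
  refine integral_congr_ae (Eventually.of_forall fun ξ => ?_)
  simp only [FT2_mul (fun x => (((Real.sqrt l₁)⁻¹ : ℝ) : ℂ) * φ ((x - c₁) / l₁))
    (fun x => (((Real.sqrt l₂)⁻¹ : ℝ) : ℂ) * φ ((x - c₂) / l₂)), mul_add, Complex.exp_add]
  ring

lemma Pdir_eq_of_support {v : ℝ × ℝ} {f : ℝ × ℝ → ℂ}
    (h : ∀ ξ : ℝ × ℝ, FT2 f ξ ≠ 0 → 0 < ξ.1 * v.1 + ξ.2 * v.2) (x : ℝ × ℝ) :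
    Pdir v f x = ((((2 * Real.pi) ^ 2 : ℝ) : ℂ))⁻¹ *
      ∫ ξ : ℝ × ℝ, FT2 f ξ * Complex.exp (Complex.I * (x.1 * ξ.1 + x.2 * ξ.2)) := by
  rw [Pdir, Set.indicator_eq_self.2]
  exact fun ξ hξ => h ξ (left_ne_zero_of_mul hξ)

lemma Pdir_eq_zero_of_support {v : ℝ × ℝ} {f : ℝ × ℝ → ℂ}
    (h : ∀ ξ : ℝ × ℝ, FT2 f ξ ≠ 0 → ξ.1 * v.1 + ξ.2 * v.2 ≤ 0) (x : ℝ × ℝ) :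
    Pdir v f x = 0 := by
  rw [Pdir, Set.indicator_eq_zero.2]
  · simp
  · rw [Set.disjoint_left]
    exact fun ξ hξ hpos => (h ξ (left_ne_zero_of_mul hξ)).not_gt hpos

/-- If `|r₂| ≤ (a/3)|r₁|` then `P_{(-1,a)} φ¹_R = φ¹_R`, while if `|r₂| ≥ 3a|r₁|` then
`P_{(-1,a)} φ¹_R = 0`. -/
theorem Pdir_wave_eq_or_zero
    (φ₁ : SchwartzMap ℝ ℂ) (hφ₁ : Phi1Hyp (⇑φ₁)) (a : ℝ) (ha : 0 < a) (R : DyadicRect) :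
    (dLen R.2 ≤ a / 3 * dLen R.1 →
      ∀ x : ℝ × ℝ, Pdir (-1, a) (wave (⇑φ₁) R) x = wave (⇑φ₁) R x) ∧
    (3 * a * dLen R.1 ≤ dLen R.2 →
      ∀ x : ℝ × ℝ, Pdir (-1, a) (wave (⇑φ₁) R) x = 0) := by
  have hl₁ : 0 < dLen R.1 := by unfold dLen; positivity
  have hl₂ : 0 < dLen R.2 := by unfold dLen; positivity
  refine ⟨fun h x => ?_, fun h x => Pdir_eq_zero_of_support (fun ξ hξ => ?_) x⟩
  · rw [Pdir_eq_of_support, wave, integral_FT2_waveG_mul_exp _ _ _ hl₁ hl₂,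
      inv_mul_cancel_left₀]
    · exact_mod_cast (pow_pos Real.two_pi_pos 2).ne'
    · intro ξ hξ
      obtain ⟨⟨h1, h2⟩, h3, h4⟩ := mem_Icc_of_FT2_waveG_ne_zero hφ₁ _ _ hl₁ hl₂ hξ
      have hξ₂ : 0 < ξ.2 := pos_of_mul_pos_right (by linarith) hl₂.le
      have := mul_le_mul_of_nonneg_right h hξ₂.le
      have : 0 < dLen R.1 * (ξ.1 * (-1) + ξ.2 * a) := by linarith
      exact pos_of_mul_pos_right this hl₁.le
  · obtain ⟨⟨h1, h2⟩, h3, h4⟩ := mem_Icc_of_FT2_waveG_ne_zero hφ₁ _ _ hl₁ hl₂ hξ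
    have hξ₂ : 0 < ξ.2 := pos_of_mul_pos_right (by linarith) hl₂.le
    have := mul_le_mul_of_nonneg_right h hξ₂.le
    have : dLen R.1 * (ξ.1 * (-1) + ξ.2 * a) ≤ 0 := by linarith
    exact nonpos_of_mul_nonpos_right this hl₁

end
end

section
/- There is an absolute constant C such that for every k ∈ ℕ, every a_k with 1/2 < 2^k a_k < 1, every dyadic rectangle R' = r'₁ × r'₂ with (a_k/3)|r'₁| < |r'₂| < 3a_k|r'₁|, and every x ∈ ℝ², the (continuous representative of the) function P_{(−1,a_k)} φ¹_{R'} satisfies |P_{(−1,a_k)} φ¹_{R'}(x)| ≤ C |R'|^{−1/2} ( 1 + |r'₁|^{−1} |(x − c(R'))·(−1,a_k)| + ( |r'₂|^{−1} |(x − c(R'))·(a_k,1)| )^{200} )^{−1}. -/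
open MeasureTheory Filter
open scoped ENNReal Topology ComplexConjugate

noncomputable section

theorem norm_exp_I_mul (u y : ℝ) : ‖Complex.exp (Complex.I * u * y)‖ = 1 := by
  have : Complex.I * u * y = ((u * y : ℝ) : ℂ) * Complex.I := by push_cast; ring
  rw [this, Complex.norm_exp_ofReal_mul_I]

theorem integrable_schwartz_mul_exp (G : SchwartzMap ℝ ℂ) (u : ℝ) :
    Integrable (fun y : ℝ => G y * Complex.exp (Complex.I * u * y)) := by
  refine (G.integrable (μ := volume)).mono
    ((G.continuous.mul (by fun_prop)).aestronglyMeasurable) (Eventually.of_forall fun y => ?_)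
  rw [norm_mul, norm_exp_I_mul, mul_one]

theorem hasDerivAt_exp_I_mul (u y : ℝ) :
    HasDerivAt (fun y : ℝ => Complex.exp (Complex.I * u * y))
      (Complex.I * u * Complex.exp (Complex.I * u * y)) y := by
  have h : HasDerivAt (fun y : ℝ => Complex.I * u * (y : ℂ)) (Complex.I * u) y := by
    simpa using (Complex.ofRealCLM.hasDerivAt (x := y)).const_mul (Complex.I * u)
  simpa [mul_comm] using h.cexp

/-- The half-line Fourier integral `∫_{t > 0} G (s + t) e^{iut} dt`. -/
def halfLineTransform (G : ℝ → ℂ) (u s : ℝ) : ℂ :=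
  Complex.exp (-(Complex.I * u * s)) * ∫ y in Set.Ioi s, G y * Complex.exp (Complex.I * u * y)

theorem norm_halfLineTransform_eq (G : ℝ → ℂ) (u s : ℝ) :
    ‖halfLineTransform G u s‖ = ‖∫ y in Set.Ioi s, G y * Complex.exp (Complex.I * u * y)‖ := by
  have h := norm_exp_I_mul (-u) s
  rw [halfLineTransform, norm_mul]
  have e : -(Complex.I * u * s) = Complex.I * ((-u : ℝ) : ℂ) * s := by push_cast; ring
  rw [e, h, one_mul]

theorem norm_halfLineTransform_le (G : SchwartzMap ℝ ℂ) (u s : ℝ) :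
    ‖halfLineTransform G u s‖ ≤ ∫ y, ‖G y‖ := by
  rw [norm_halfLineTransform_eq]
  refine (norm_integral_le_integral_norm _).trans ?_
  simp only [norm_mul, norm_exp_I_mul, mul_one]
  exact setIntegral_le_integral (G.integrable (μ := volume)).norm
    (Eventually.of_forall fun _ => norm_nonneg _)

/-- Integration by parts on a half-line. -/
theorem I_mul_halfLineTransform (G : SchwartzMap ℝ ℂ) (u s : ℝ) :
    Complex.I * u * halfLineTransform G u s =
      -G s - halfLineTransform (SchwartzMap.derivCLM ℂ ℂ G) u s := by
  have hint := integrable_schwartz_mul_exp G u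
  have hint' := integrable_schwartz_mul_exp (SchwartzMap.derivCLM ℂ ℂ G) u
  have h0 : Tendsto (fun y : ℝ => G y * Complex.exp (Complex.I * u * y)) atTop (𝓝 0) := by
    have hG : Tendsto (fun y => ‖G y‖) atTop (𝓝 0) := by
      simpa using (G.toZeroAtInfty.zero_at_infty'.mono_left atTop_le_cocompact).norm
    refine squeeze_zero_norm (fun y => ?_) hG
    rw [norm_mul, norm_exp_I_mul, mul_one]
  have key := integral_Ioi_of_hasDerivAt_of_tendsto' (a := s)
    (f' := fun y => SchwartzMap.derivCLM ℂ ℂ G y * Complex.exp (Complex.I * u * y) +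
      Complex.I * u * (G y * Complex.exp (Complex.I * u * y)))
    (fun y _ => ((G.hasDerivAt y).mul (hasDerivAt_exp_I_mul u y)).congr_deriv
      (by rw [SchwartzMap.derivCLM_apply]; ring))
    ((hint'.add (hint.const_mul _)).integrableOn) h0
  rw [integral_add hint'.integrableOn (hint.const_mul _).integrableOn, integral_const_mul] at key
  have hexp : Complex.exp (-(Complex.I * u * s)) * Complex.exp (Complex.I * u * s) = 1 := by
    rw [← Complex.exp_add]; simp
  simp only [halfLineTransform]
  simp only [Pi.mul_apply] at key
  linear_combination Complex.exp (-(Complex.I * u * s)) * key - G s * hexp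

theorem hasDerivAt_halfLineTransform (G : SchwartzMap ℝ ℂ) (u s : ℝ) :
    HasDerivAt (halfLineTransform G u)
      (halfLineTransform (SchwartzMap.derivCLM ℂ ℂ G) u s) s := by
  have hint := integrable_schwartz_mul_exp G u
  set f : ℝ → ℂ := fun y => G y * Complex.exp (Complex.I * u * y) with hf
  have hc : Continuous f := G.continuous.mul (by fun_prop)
  have h1 : HasDerivAt (fun s => ∫ y in Set.Ioi s, f y) (-f s) s := by
    have e : (fun s => ∫ y in Set.Ioi s, f y) =
        fun s => (∫ y in Set.Ioi 0, f y) - ∫ y in (0 : ℝ)..s, f y := by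
      ext s
      rw [eq_sub_iff_add_eq']
      exact intervalIntegral.integral_interval_add_Ioi hint.integrableOn hint.integrableOn
    rw [e]
    exact (intervalIntegral.integral_hasDerivAt_right (hc.intervalIntegrable _ _)
      (hc.stronglyMeasurableAtFilter _ _) hc.continuousAt).const_sub _
  have h2 := (hasDerivAt_exp_I_mul (-u) s).mul h1
  have e : halfLineTransform G u = fun s : ℝ => Complex.exp (Complex.I * ((-u : ℝ) : ℂ) * s) *
      ∫ y in Set.Ioi s, f y := by
    ext s
    simp [halfLineTransform, hf]
  rw [e]
  refine h2.congr_deriv ?_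
  have h3 := I_mul_halfLineTransform G u s
  rw [e] at h3
  have h4 : Complex.exp (Complex.I * ((-u : ℝ) : ℂ) * s) * Complex.exp (Complex.I * u * s) = 1 := by
    rw [← Complex.exp_add]; simp
  have h5 : halfLineTransform (SchwartzMap.derivCLM ℂ ℂ G) u s =
      -G s - Complex.I * u * (Complex.exp (Complex.I * ((-u : ℝ) : ℂ) * s) *
        ∫ y in Set.Ioi s, f y) := by linear_combination h3
  rw [h5]
  simp only [hf]
  push_cast at *
  linear_combination (-G s) * h4

theorem abs_mul_norm_halfLineTransform_le (G : SchwartzMap ℝ ℂ) (u s : ℝ) :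
    |u| * ‖halfLineTransform G u s‖ ≤
      SchwartzMap.seminorm ℂ 0 0 G + ∫ y, ‖SchwartzMap.derivCLM ℂ ℂ G y‖ := by
  have h := congrArg norm (I_mul_halfLineTransform G u s)
  rw [norm_mul, norm_mul, Complex.norm_I, one_mul, Complex.norm_real, Real.norm_eq_abs] at h
  rw [h]
  refine (norm_sub_le _ _).trans (add_le_add ?_ (norm_halfLineTransform_le _ u s))
  rw [norm_neg]
  exact SchwartzMap.norm_le_seminorm ℂ G s

/-- The Fourier integral of `G₁ ⊗ G₂` over the half-plane above the line of slope `β`, at the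
frequency `(w - β * u, u)`. -/
def halfPlaneTransform (G₁ G₂ : ℝ → ℂ) (u w β : ℝ) : ℂ :=
  ∫ η : ℝ, G₁ η * Complex.exp (Complex.I * w * η) * halfLineTransform G₂ u (β * η)

theorem continuous_halfLineTransform (G : SchwartzMap ℝ ℂ) (u : ℝ) :
    Continuous (halfLineTransform G u) :=
  continuous_iff_continuousAt.2 fun s => (hasDerivAt_halfLineTransform G u s).continuousAt

theorem integrable_halfPlaneTransform (G₁ G₂ : SchwartzMap ℝ ℂ) (u w β : ℝ) :
    Integrable fun η : ℝ =>
      G₁ η * Complex.exp (Complex.I * w * η) * halfLineTransform G₂ u (β * η) :=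
  (integrable_schwartz_mul_exp G₁ w).mul_bdd (c := ∫ y, ‖G₂ y‖)
    ((continuous_halfLineTransform G₂ u).comp (by fun_prop)).aestronglyMeasurable
    (Eventually.of_forall fun η => norm_halfLineTransform_le G₂ u (β * η))

theorem mul_norm_halfPlaneTransform_le (G₁ : SchwartzMap ℝ ℂ) (G₂ : ℝ → ℂ) (u w β : ℝ)
    {c M : ℝ} (hc : 0 ≤ c) (hM : ∀ s, c * ‖halfLineTransform G₂ u s‖ ≤ M) :
    c * ‖halfPlaneTransform G₁ G₂ u w β‖ ≤ (∫ y, ‖G₁ y‖) * M := by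
  have h : ‖(c : ℂ) * halfPlaneTransform G₁ G₂ u w β‖ ≤ ∫ y, ‖G₁ y‖ * M := by
    rw [halfPlaneTransform, ← integral_const_mul]
    refine norm_integral_le_of_norm_le ((G₁.integrable (μ := volume)).norm.mul_const M)
      (Eventually.of_forall fun η => ?_)
    rw [norm_mul, norm_mul, norm_mul, norm_exp_I_mul, mul_one, Complex.norm_real,
      Real.norm_of_nonneg hc, mul_left_comm]
    exact mul_le_mul_of_nonneg_left (hM _) (norm_nonneg _)
  rwa [norm_mul, Complex.norm_real, Real.norm_of_nonneg hc, integral_mul_const] at h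

/-- Integration by parts along the boundary of the half-plane. -/
theorem I_mul_halfPlaneTransform (G₁ G₂ : SchwartzMap ℝ ℂ) (u w β : ℝ) :
    Complex.I * w * halfPlaneTransform G₁ G₂ u w β =
      -(halfPlaneTransform (SchwartzMap.derivCLM ℂ ℂ G₁) G₂ u w β +
        β * halfPlaneTransform G₁ (SchwartzMap.derivCLM ℂ ℂ G₂) u w β) := by
  have i0 := integrable_halfPlaneTransform G₁ G₂ u w β
  have i1 := integrable_halfPlaneTransform (SchwartzMap.derivCLM ℂ ℂ G₁) G₂ u w β
  have i2 := integrable_halfPlaneTransform G₁ (SchwartzMap.derivCLM ℂ ℂ G₂) u w β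
  have hT : ∀ η : ℝ, HasDerivAt (fun η : ℝ => halfLineTransform G₂ u (β * η))
      (β * halfLineTransform (SchwartzMap.derivCLM ℂ ℂ G₂) u (β * η)) η := fun η => by
    have h := (hasDerivAt_halfLineTransform G₂ u (β * η)).scomp η
      ((hasDerivAt_id η).const_mul β)
    exact h.congr_deriv (by simp)
  have key := integral_eq_zero_of_hasDerivAt_of_integrable
    (fun η => (((G₁.hasDerivAt η).mul (hasDerivAt_exp_I_mul w η)).mul (hT η)).congr_deriv
      (g' := SchwartzMap.derivCLM ℂ ℂ G₁ η * Complex.exp (Complex.I * w * η) *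
          halfLineTransform G₂ u (β * η) +
        β * (G₁ η * Complex.exp (Complex.I * w * η) *
          halfLineTransform (SchwartzMap.derivCLM ℂ ℂ G₂) u (β * η)) +
        Complex.I * w * (G₁ η * Complex.exp (Complex.I * w * η) *
          halfLineTransform G₂ u (β * η)))
      (by rw [SchwartzMap.derivCLM_apply]; simp only [Pi.mul_apply]; ring))
    ((i1.add (i2.const_mul _)).add (i0.const_mul _)) i0
  have e := integral_add (i1.add (i2.const_mul (β : ℂ))) (i0.const_mul (Complex.I * w))
  simp only [Pi.add_apply] at e
  rw [e, integral_add i1 (i2.const_mul _), integral_const_mul, integral_const_mul] at key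
  simp only [halfPlaneTransform]
  linear_combination key

theorem exists_pow_mul_norm_halfPlaneTransform_le (b : ℝ) (N : ℕ) :
    ∀ G₁ G₂ : SchwartzMap ℝ ℂ, ∃ C : ℝ, ∀ u w β : ℝ, |β| ≤ b →
      |w| ^ N * ‖halfPlaneTransform G₁ G₂ u w β‖ ≤ C := by
  induction N with
  | zero =>
    refine fun G₁ G₂ => ⟨(∫ y, ‖G₁ y‖) * ∫ y, ‖G₂ y‖, fun u w β _ => ?_⟩
    rw [pow_zero]
    refine mul_norm_halfPlaneTransform_le G₁ G₂ u w β zero_le_one fun s => ?_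
    rw [one_mul]
    exact norm_halfLineTransform_le G₂ u s
  | succ N ih =>
    intro G₁ G₂
    obtain ⟨C₁, h₁⟩ := ih (SchwartzMap.derivCLM ℂ ℂ G₁) G₂
    obtain ⟨C₂, h₂⟩ := ih G₁ (SchwartzMap.derivCLM ℂ ℂ G₂)
    refine ⟨C₁ + b * C₂, fun u w β hβ => ?_⟩
    have h := congrArg norm (I_mul_halfPlaneTransform G₁ G₂ u w β)
    rw [norm_mul, norm_mul, Complex.norm_I, one_mul, Complex.norm_real, Real.norm_eq_abs,
      norm_neg] at h
    rw [pow_succ, mul_assoc, h]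
    have hb : 0 ≤ b := (abs_nonneg β).trans hβ
    calc _ ≤ |w| ^ N * (‖halfPlaneTransform (SchwartzMap.derivCLM ℂ ℂ G₁) G₂ u w β‖ +
          |β| * ‖halfPlaneTransform G₁ (SchwartzMap.derivCLM ℂ ℂ G₂) u w β‖) := by
          gcongr
          refine (norm_add_le _ _).trans_eq ?_
          rw [norm_mul, Complex.norm_real, Real.norm_eq_abs]
      _ = |w| ^ N * ‖halfPlaneTransform (SchwartzMap.derivCLM ℂ ℂ G₁) G₂ u w β‖ +
          |β| * (|w| ^ N * ‖halfPlaneTransform G₁ (SchwartzMap.derivCLM ℂ ℂ G₂) u w β‖) := by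
          ring
      _ ≤ C₁ + b * C₂ := by
          gcongr
          · exact h₁ u w β hβ
          · exact h₂ u w β hβ

/-- The one-dimensional Fourier transform of a Schwartz function is a Schwartz function. -/
theorem exists_schwartz_eq_FT1 (φ : SchwartzMap ℝ ℂ) :
    ∃ G : SchwartzMap ℝ ℂ, ∀ ξ, G ξ = FT1 φ ξ := by
  refine ⟨SchwartzMap.compCLMOfContinuousLinearEquiv ℂ
    (ContinuousLinearEquiv.unitsEquivAut ℝ (Units.mk0 (2 * Real.pi)⁻¹ (by positivity)))
    (FourierTransform.fourier φ), fun ξ => ?_⟩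
  have hpi := Real.pi_ne_zero
  rw [SchwartzMap.compCLMOfContinuousLinearEquiv_apply, Function.comp_apply,
    SchwartzMap.fourier_coe, Real.fourier_real_eq_integral_exp_smul, FT1]
  congr 1 with v
  rw [smul_eq_mul]
  congr 2
  simp only [ContinuousLinearEquiv.unitsEquivAut_apply, Units.val_mk0]
  push_cast
  have : (Real.pi : ℂ) ≠ 0 := by exact_mod_cast hpi
  field_simp

theorem integral_exp_mul_comp_affine (φ : ℝ → ℂ) (c ξ : ℝ) {l : ℝ} (hl : 0 < l) :
    ∫ x : ℝ, Complex.exp (-(Complex.I * (x * ξ))) * φ ((x - c) / l) =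
      l * Complex.exp (-(Complex.I * (c * ξ))) * FT1 φ (l * ξ) := by
  have h1 := integral_add_right_eq_self (μ := volume)
    (fun x : ℝ => Complex.exp (-(Complex.I * (x * ξ))) * φ ((x - c) / l)) c
  have h2 := Measure.integral_comp_mul_left
    (fun x : ℝ => Complex.exp (-(Complex.I * (((x + c : ℝ) : ℂ) * ξ))) * φ (((x + c) - c) / l)) l
  rw [← h1]
  have hl' : (l : ℂ) ≠ 0 := by exact_mod_cast hl.ne'
  rw [abs_of_pos (inv_pos.2 hl), Complex.real_smul, Complex.ofReal_inv] at h2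
  rw [eq_comm, inv_mul_eq_iff_eq_mul₀ hl'] at h2
  rw [h2, FT1, mul_assoc]
  simp only [← integral_const_mul]
  congr 1 with x
  rw [add_sub_cancel_right, mul_div_cancel_left₀ _ hl.ne', ← mul_assoc (Complex.exp _),
    ← Complex.exp_add]
  congr 3
  push_cast
  ring

theorem FT2_waveG (φ : ℝ → ℂ) (c₁ c₂ : ℝ) {l₁ l₂ : ℝ} (h₁ : 0 < l₁) (h₂ : 0 < l₂)
    (ξ : ℝ × ℝ) :
    FT2 (waveG φ c₁ l₁ c₂ l₂) ξ =
      (((Real.sqrt l₁)⁻¹ * (Real.sqrt l₂)⁻¹ : ℝ) : ℂ) *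
        ((l₁ * Complex.exp (-(Complex.I * (c₁ * ξ.1))) * FT1 φ (l₁ * ξ.1)) *
          (l₂ * Complex.exp (-(Complex.I * (c₂ * ξ.2))) * FT1 φ (l₂ * ξ.2))) := by
  rw [← integral_exp_mul_comp_affine φ c₁ ξ.1 h₁, ← integral_exp_mul_comp_affine φ c₂ ξ.2 h₂,
    ← integral_prod_mul, ← integral_const_mul, FT2]
  refine integral_congr_ae (Eventually.of_forall fun x => ?_)
  simp only [waveG]
  rw [mul_add, neg_add, Complex.exp_add]
  ring

theorem halfPlaneTransform_eq (G₁ G₂ : ℝ → ℂ) (u v β : ℝ) :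
    halfPlaneTransform G₁ G₂ u (v + β * u) β =
      ∫ η : ℝ, G₁ η * Complex.exp (Complex.I * v * η) *
        ∫ y in Set.Ioi (β * η), G₂ y * Complex.exp (Complex.I * u * y) := by
  rw [halfPlaneTransform]
  congr 1 with η
  rw [halfLineTransform, ← mul_assoc, mul_assoc (G₁ η), ← Complex.exp_add]
  congr 4
  push_cast
  ring

/-- Fubini and rescaling for an integral over the half-plane `ξ ⬝ (-1, a) > 0`. -/
theorem integral_indicator_halfPlane {g₁ g₂ : ℝ → ℂ} (hg₁ : Integrable g₁)
    (hg₂ : Integrable g₂) {a l₁ l₂ : ℝ} (ha : 0 < a) (h₁ : 0 < l₁) (h₂ : 0 < l₂) :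
    ∫ ξ : ℝ × ℝ, Set.indicator {ξ : ℝ × ℝ | 0 < ξ.1 * (-1) + ξ.2 * a}
        (fun ξ => g₁ (l₁ * ξ.1) * g₂ (l₂ * ξ.2)) ξ =
      (l₁ : ℂ)⁻¹ * (l₂ : ℂ)⁻¹ *
        ∫ η, g₁ η * ∫ y in Set.Ioi (l₂ / (a * l₁) * η), g₂ y := by
  have hS : MeasurableSet {ξ : ℝ × ℝ | 0 < ξ.1 * (-1) + ξ.2 * a} :=
    measurableSet_lt measurable_const (by fun_prop)
  have hint := ((hg₁.comp_mul_left' h₁.ne').mul_prod (hg₂.comp_mul_left' h₂.ne')).indicator hS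
  rw [Measure.volume_eq_prod, integral_prod _ hint]
  have inner : ∀ ξ₁ : ℝ, ∫ ξ₂ : ℝ, Set.indicator {ξ : ℝ × ℝ | 0 < ξ.1 * (-1) + ξ.2 * a}
        (fun ξ => g₁ (l₁ * ξ.1) * g₂ (l₂ * ξ.2)) (ξ₁, ξ₂) =
      (l₂ : ℂ)⁻¹ *
        (g₁ (l₁ * ξ₁) * ∫ y in Set.Ioi (l₂ / (a * l₁) * (l₁ * ξ₁)), g₂ y) := fun ξ₁ => by
    rw [← integral_indicator measurableSet_Ioi]
    have h := Measure.integral_comp_mul_left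
      ((Set.Ioi (l₂ / (a * l₁) * (l₁ * ξ₁))).indicator g₂) l₂
    rw [abs_of_pos (inv_pos.2 h₂), Complex.real_smul, Complex.ofReal_inv] at h
    rw [mul_left_comm, ← h, ← integral_const_mul]
    congr 1 with ξ₂
    have hiff : l₂ / (a * l₁) * (l₁ * ξ₁) < l₂ * ξ₂ ↔ 0 < ξ₁ * (-1) + ξ₂ * a := by
      have e : l₂ / (a * l₁) * (l₁ * ξ₁) = l₂ * (ξ₁ / a) := by field_simp
      rw [e, mul_lt_mul_iff_right₀ h₂, div_lt_iff₀ ha]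
      constructor <;> intro h <;> linarith
    simp only [Set.indicator_apply, Set.mem_ofPred_eq, Set.mem_Ioi, hiff, mul_ite, mul_zero]
  simp_rw [inner]
  rw [integral_const_mul]
  have h := Measure.integral_comp_mul_left
    (fun η => g₁ η * ∫ y in Set.Ioi (l₂ / (a * l₁) * η), g₂ y) l₁
  rw [abs_of_pos (inv_pos.2 h₁), Complex.real_smul, Complex.ofReal_inv] at h
  rw [h]
  ring

theorem Pdir_waveG (G : SchwartzMap ℝ ℂ) {φ : ℝ → ℂ} (hG : ∀ ξ, G ξ = FT1 φ ξ)
    {a l₁ l₂ : ℝ} (ha : 0 < a) (h₁ : 0 < l₁) (h₂ : 0 < l₂) (c₁ c₂ : ℝ) (x : ℝ × ℝ) :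
    Pdir (-1, a) (waveG φ c₁ l₁ c₂ l₂) x =
      ((((2 * Real.pi) ^ 2)⁻¹ * ((Real.sqrt l₁)⁻¹ * (Real.sqrt l₂)⁻¹) : ℝ) : ℂ) *
        halfPlaneTransform G G ((x.2 - c₂) / l₂)
          ((x.1 - c₁) / l₁ + l₂ / (a * l₁) * ((x.2 - c₂) / l₂)) (l₂ / (a * l₁)) := by
  have hl₁ : (l₁ : ℂ) ≠ 0 := by exact_mod_cast h₁.ne'
  have hl₂ : (l₂ : ℂ) ≠ 0 := by exact_mod_cast h₂.ne'
  have key := integral_indicator_halfPlane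
    (integrable_schwartz_mul_exp G ((x.1 - c₁) / l₁))
    (integrable_schwartz_mul_exp G ((x.2 - c₂) / l₂)) ha h₁ h₂
  rw [← halfPlaneTransform_eq] at key
  have hinv : halfPlaneTransform G G ((x.2 - c₂) / l₂)
      ((x.1 - c₁) / l₁ + l₂ / (a * l₁) * ((x.2 - c₂) / l₂)) (l₂ / (a * l₁)) =
      l₁ * l₂ * ((l₁ : ℂ)⁻¹ * (l₂ : ℂ)⁻¹ * halfPlaneTransform G G ((x.2 - c₂) / l₂)
      ((x.1 - c₁) / l₁ + l₂ / (a * l₁) * ((x.2 - c₂) / l₂)) (l₂ / (a * l₁))) := by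
    field_simp
  rw [hinv, ← key, Pdir, Complex.ofReal_mul, mul_assoc, Complex.ofReal_inv]
  congr 1
  rw [← mul_assoc, ← integral_const_mul]
  congr 1 with ξ
  simp only [Set.indicator_apply, mul_ite, mul_zero, FT2_waveG φ c₁ c₂ h₁ h₂, ← hG]
  congr 1
  have e₁ : Complex.exp (Complex.I * (x.1 * ξ.1 + x.2 * ξ.2)) *
      (Complex.exp (-(Complex.I * (c₁ * ξ.1))) * Complex.exp (-(Complex.I * (c₂ * ξ.2)))) =
      Complex.exp (Complex.I * (((x.1 - c₁) / l₁ : ℝ) : ℂ) * ((l₁ * ξ.1 : ℝ) : ℂ)) *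
        Complex.exp (Complex.I * (((x.2 - c₂) / l₂ : ℝ) : ℂ) * ((l₂ * ξ.2 : ℝ) : ℂ)) := by
    rw [← Complex.exp_add, ← Complex.exp_add, ← Complex.exp_add]
    congr 1
    push_cast
    field_simp
    ring
  linear_combination (((Real.sqrt l₁)⁻¹ * (Real.sqrt l₂)⁻¹ : ℝ) : ℂ) * l₁ * l₂ *
    G (l₁ * ξ.1) * G (l₂ * ξ.2) * e₁

/-- The pointwise estimate for `P_{(-1,a_k)} φ¹_{R'}` (the continuous representative being the
explicit inversion integral `Pdir`):  decay of order `1` in the direction `(-1,a_k)` and of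
order `200` in the orthogonal direction `(a_k,1)`, at the scales of `R'`. -/
theorem pointwise_estimate_Pdir_wave
    (φ₁ : SchwartzMap ℝ ℂ) (hφ₁ : Phi1Hyp (⇑φ₁)) :
    ∃ C : ℝ, 0 < C ∧
      ∀ k : ℕ, ∀ a : ℝ, 1/2 < 2 ^ k * a → 2 ^ k * a < 1 →
      ∀ R' : DyadicRect, a / 3 * dLen R'.1 < dLen R'.2 → dLen R'.2 < 3 * a * dLen R'.1 →
      ∀ x : ℝ × ℝ,
        ‖Pdir (-1, a) (wave (⇑φ₁) R') x‖ ≤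
          C * (Real.sqrt (rArea R'))⁻¹ *
            (1 + (dLen R'.1)⁻¹ * |(x.1 - dCtr R'.1) * (-1) + (x.2 - dCtr R'.2) * a| +
              ((dLen R'.2)⁻¹ * |(x.1 - dCtr R'.1) * a + (x.2 - dCtr R'.2) * 1|) ^ (200 : ℕ))⁻¹ := by
  obtain ⟨G, hG⟩ := exists_schwartz_eq_FT1 φ₁
  obtain ⟨C₀, h₀⟩ := exists_pow_mul_norm_halfPlaneTransform_le 3 0 G G
  obtain ⟨C₁, h₁⟩ := exists_pow_mul_norm_halfPlaneTransform_le 3 1 G G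
  obtain ⟨C₂, h₂⟩ := exists_pow_mul_norm_halfPlaneTransform_le 3 200 G G
  set D : ℝ := (∫ y, ‖G y‖) *
    (SchwartzMap.seminorm ℂ 0 0 G + ∫ y, ‖SchwartzMap.derivCLM ℂ ℂ G y‖)
  refine ⟨max 1 (C₀ + (C₁ + 6 * D) + 3 ^ 200 * C₂), by positivity, ?_⟩
  intro k a hak hak' R hR hR' x
  have hl₁ : 0 < dLen R.1 := zpow_pos two_pos _
  have hl₂ : 0 < dLen R.2 := zpow_pos two_pos _
  have hpow : (1 : ℝ) ≤ 2 ^ k := one_le_pow₀ one_le_two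
  have ha : 0 < a := by
    by_contra! h
    nlinarith
  have ha1 : a < 1 := by nlinarith
  rw [wave, Pdir_waveG G hG ha hl₁ hl₂]
  set l₁ := dLen R.1
  set l₂ := dLen R.2
  set c₁ := dCtr R.1
  set c₂ := dCtr R.2
  set β := l₂ / (a * l₁) with hβ
  set u := (x.2 - c₂) / l₂ with hu
  set w := (x.1 - c₁) / l₁ + β * u with hw
  have hβ0 : 1 / 3 < β := by
    rw [hβ, lt_div_iff₀ (by positivity)]
    linarith
  have hβ3 : β < 3 := by
    rw [hβ, div_lt_iff₀ (by positivity)]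
    linarith
  have hβabs : |β| ≤ 3 := abs_le.2 ⟨by linarith, hβ3.le⟩
  specialize h₀ u w β hβabs
  specialize h₁ u w β hβabs
  specialize h₂ u w β hβabs
  have h₃ : |u| * ‖halfPlaneTransform G G u w β‖ ≤ D :=
    mul_norm_halfPlaneTransform_le G G u w β (abs_nonneg u)
      (abs_mul_norm_halfLineTransform_le G u)
  set K := ‖halfPlaneTransform G G u w β‖
  have hK : 0 ≤ K := norm_nonneg _
  rw [pow_zero, one_mul] at h₀
  rw [pow_one] at h₁
  set A := l₁⁻¹ * |(x.1 - c₁) * (-1) + (x.2 - c₂) * a|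
  set B := l₂⁻¹ * |(x.1 - c₁) * a + (x.2 - c₂) * 1|
  have hA : A ≤ |w| + 6 * |u| := by
    have e : A = |-w + (1 + a ^ 2) * β * u| := by
      simp only [A]
      rw [← abs_of_pos (inv_pos.2 hl₁), ← abs_mul, hw, hu, hβ]
      congr 1
      field_simp
      ring
    rw [e]
    refine (abs_add_le _ _).trans ?_
    rw [abs_neg, abs_mul, abs_of_pos (show 0 < (1 + a ^ 2) * β by positivity)]
    have : (1 + a ^ 2) * β ≤ 6 := by nlinarith
    gcongr
  have hB : B ≤ 3 * |w| := by
    have e : B * β = |w| := by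
      simp only [B]
      have e' : w = l₂⁻¹ * ((x.1 - c₁) * a + (x.2 - c₂) * 1) * β := by
        rw [hw, hu, hβ]
        field_simp
      rw [e', abs_mul, abs_mul, abs_of_pos (inv_pos.2 hl₂), abs_of_pos (by linarith : 0 < β)]
    have hB0 : 0 ≤ B := by positivity
    nlinarith
  have hA0 : 0 ≤ A := by positivity
  have hB0 : 0 ≤ B := by positivity
  have hAK : A * K ≤ C₁ + 6 * D := by nlinarith
  have hBK : B ^ 200 * K ≤ 3 ^ 200 * C₂ := by
    calc B ^ 200 * K ≤ (3 * |w|) ^ 200 * K := by gcongr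
      _ = 3 ^ 200 * (|w| ^ 200 * K) := by rw [mul_pow, mul_assoc]
      _ ≤ 3 ^ 200 * C₂ := by gcongr
  have hsum : K * (1 + A + B ^ 200) ≤ max 1 (C₀ + (C₁ + 6 * D) + 3 ^ 200 * C₂) := by
    refine le_trans ?_ (le_max_right _ _)
    calc K * (1 + A + B ^ 200) = K + A * K + B ^ 200 * K := by ring
      _ ≤ _ := add_le_add (add_le_add h₀ hAK) hBK
  have hS : 0 < 1 + A + B ^ 200 :=
    add_pos_of_pos_of_nonneg (by linarith) (pow_nonneg hB0 200)
  have hpi : ((2 * Real.pi) ^ 2)⁻¹ ≤ 1 :=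
    inv_le_one_of_one_le₀ (one_le_pow₀ (by linarith [Real.pi_gt_three]))
  rw [norm_mul, Complex.norm_real, Real.norm_of_nonneg (by positivity), rArea,
    Real.sqrt_mul hl₁.le, mul_inv]
  calc _ ≤ 1 * ((Real.sqrt l₁)⁻¹ * (Real.sqrt l₂)⁻¹) * K := by gcongr
    _ = ((Real.sqrt l₁)⁻¹ * (Real.sqrt l₂)⁻¹) * K := by rw [one_mul]
    _ ≤ ((Real.sqrt l₁)⁻¹ * (Real.sqrt l₂)⁻¹) *
        (max 1 (C₀ + (C₁ + 6 * D) + 3 ^ 200 * C₂) * (1 + A + B ^ 200)⁻¹) := by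
        gcongr
        rw [← div_eq_mul_inv, le_div_iff₀ hS]
        exact hsum
    _ = _ := by ring

end
end

section
/- (John–Nirenberg inequality for Carleson measures on the bidisk.) For all 0 < p, q < ∞ there is a constant C_{p,q} such that for every function a from the dyadic rectangles of ℝ² to [0,∞), ‖a‖_{CM,p} ≤ C_{p,q} ‖a‖_{CM,q}. -/
open MeasureTheory Filter
open scoped ENNReal Topology

noncomputable section

/-- `F_U = Σ_{R ⊆ U} a(R) 1_R`. -/
def FU (a : DyadicRect → ℝ) (U : Set (ℝ × ℝ)) (x : ℝ × ℝ) : ℝ≥0∞ :=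
  ∑' R : {R : DyadicRect // rSet R ⊆ U},
    ENNReal.ofReal (a R.1) * Set.indicator (rSet R.1) (fun _ => (1 : ℝ≥0∞)) x

/-- The Carleson measure norm `‖a‖_{CM,p} = sup_U |U|^{-1/p} ‖F_U‖_{L^p}`, the supremum being
over open sets `U ⊆ ℝ²` of positive finite measure. -/
def CMnorm (a : DyadicRect → ℝ) (p : ℝ) : ℝ≥0∞ :=
  ⨆ U : {U : Set (ℝ × ℝ) // IsOpen U ∧ 0 < volume U ∧ volume U < ⊤},
    (volume U.1) ^ (-(1/p)) * (∫⁻ x, (FU a U.1 x) ^ p ∂volume) ^ (1/p)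

lemma rpow_eq_mul_rpow_sub_one (x : ℝ≥0∞) {s : ℝ} (hs : 1 ≤ s) : x ^ s = x * x ^ (s - 1) := by
  conv_rhs => rw [← ENNReal.rpow_one x, ← ENNReal.rpow_mul, one_mul,
    ← ENNReal.rpow_add_of_nonneg _ _ zero_le_one (sub_nonneg.2 hs)]
  simp

/-! ### One-parameter dyadic maximal function -/

lemma dSet_volume (I : DyadicIntvl) : volume (dSet I) = ENNReal.ofReal ((2 : ℝ) ^ I.2) := by
  rw [dSet, Real.volume_Ico]
  congr 1
  ring

lemma dSet_volume_ne_zero (I : DyadicIntvl) : volume (dSet I) ≠ 0 := by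
  rw [dSet_volume]
  have : (0 : ℝ) < 2 ^ I.2 := by positivity
  simpa using this

lemma dSet_volume_ne_top (I : DyadicIntvl) : volume (dSet I) ≠ ⊤ := by
  rw [dSet_volume]
  exact ENNReal.ofReal_ne_top

lemma measurableSet_dSet (I : DyadicIntvl) : MeasurableSet (dSet I) := measurableSet_Ico

/-- A dyadic interval is either contained in a given longer one or disjoint from it. -/
lemma dSet_subset_or_disjoint {I J : DyadicIntvl} (h : J.2 ≤ I.2) :
    dSet J ⊆ dSet I ∨ Disjoint (dSet J) (dSet I) := by
  obtain ⟨m, n⟩ := I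
  obtain ⟨k, l⟩ := J
  obtain ⟨d, rfl⟩ : ∃ d : ℕ, n = l + d := ⟨(n - l).toNat, by simp at h; omega⟩
  have hl : (0 : ℝ) < 2 ^ l := by positivity
  have hn : (2 : ℝ) ^ (l + (d : ℤ)) = ((2 ^ d : ℤ) : ℝ) * 2 ^ l := by
    rw [zpow_add₀ (by norm_num)]
    push_cast
    rw [zpow_natCast]
    ring
  simp only [dSet, hn, ← mul_assoc]
  generalize (2 : ℤ) ^ d = D
  by_cases h1 : m * D ≤ k ∧ k + 1 ≤ (m + 1) * D
  · left
    have h2 : (m : ℝ) * D ≤ k := by exact_mod_cast h1.1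
    have h3 : (k : ℝ) + 1 ≤ (m + 1) * D := by exact_mod_cast h1.2
    apply Set.Ico_subset_Ico <;> gcongr
  · right
    rw [Set.Ico_disjoint_Ico]
    by_cases h2 : m * D ≤ k
    · have h3 : (m + 1) * D ≤ k := by
        by_contra h3
        exact h1 ⟨h2, by omega⟩
      have h4 : ((m : ℝ) + 1) * D ≤ k := by exact_mod_cast h3
      exact (min_le_right _ _).trans (le_trans (by gcongr) (le_max_left _ _))
    · have h3 : k + 1 ≤ m * D := by omega
      have h4 : (k : ℝ) + 1 ≤ m * D := by exact_mod_cast h3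
      exact (min_le_left _ _).trans (le_trans (by gcongr) (le_max_right _ _))

lemma mul_volume_biUnion_dSet_le (g : ℝ → ℝ≥0∞) (c : ℝ≥0∞) (s : Finset DyadicIntvl)
    (hs : ∀ I ∈ s, c * volume (dSet I) ≤ ∫⁻ t in dSet I, g t) :
    c * volume (⋃ I ∈ s, dSet I) ≤ ∫⁻ t in ⋃ I ∈ s, dSet I, g t := by
  classical
  induction s using Finset.strongInduction with
  | H s ih =>
    rcases s.eq_empty_or_nonempty with rfl | hne
    · simp
    obtain ⟨I, hI, hmax⟩ := s.exists_max_image (fun I => I.2) hne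
    set s' := s.filter (fun J => Disjoint (dSet J) (dSet I)) with hs'
    have hss : s' ⊂ s := by
      refine Finset.filter_ssubset.2 ⟨I, hI, fun h => ?_⟩
      have h0 := dSet_volume_ne_zero I
      rw [disjoint_self.1 h] at h0
      simp at h0
    have hU : (⋃ J ∈ s, dSet J) = dSet I ∪ ⋃ J ∈ s', dSet J := by
      apply Set.Subset.antisymm
      · refine Set.iUnion₂_subset fun J hJ => ?_
        rcases dSet_subset_or_disjoint (hmax J hJ) with h | h
        · exact h.trans Set.subset_union_left
        · exact (Set.subset_biUnion_of_mem (u := dSet) (s := {J | J ∈ s'})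
            (by simp [hs', hJ, h])).trans Set.subset_union_right
      · refine Set.union_subset (Set.subset_biUnion_of_mem (u := dSet) (s := {J | J ∈ s}) hI) ?_
        exact Set.biUnion_subset_biUnion_left fun J hJ => hss.1 hJ
    have hd : Disjoint (dSet I) (⋃ J ∈ s', dSet J) := by
      simp only [Set.disjoint_iUnion_right]
      intro J hJ
      exact (Finset.mem_filter.1 hJ).2.symm
    have hm : MeasurableSet (⋃ J ∈ s', dSet J) :=
      s'.measurableSet_biUnion fun J _ => measurableSet_dSet J
    rw [hU, measure_union hd hm, lintegral_union hm hd, mul_add]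
    exact add_le_add (hs I hI) (ih s' hss fun J hJ => hs J (hss.1 hJ))

/-- The dyadic maximal function on the line. -/
def dMax (g : ℝ → ℝ≥0∞) (x : ℝ) : ℝ≥0∞ :=
  ⨆ I : DyadicIntvl,
    (dSet I).indicator (fun _ => (volume (dSet I))⁻¹ * ∫⁻ t in dSet I, g t) x

lemma inv_mul_lintegral_le_dMax (g : ℝ → ℝ≥0∞) {I : DyadicIntvl} {x : ℝ} (hx : x ∈ dSet I) :
    (volume (dSet I))⁻¹ * ∫⁻ t in dSet I, g t ≤ dMax g x := by
  refine le_trans (le_of_eq ?_) (le_iSup _ I)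
  simp [hx]

lemma measurable_dMax (g : ℝ → ℝ≥0∞) : Measurable (dMax g) :=
  Measurable.iSup fun I => measurable_const.indicator (measurableSet_dSet I)

lemma mul_volume_lt_dMax_le {g : ℝ → ℝ≥0∞} (hg : Measurable g) {c : ℝ≥0∞} (hc : c ≠ ⊤) :
    c * volume {x | c < dMax g x} ≤ 2 * ∫⁻ t in {t | c / 2 < g t}, g t := by
  classical
  set T := {t | c / 2 < g t} with hT
  have hTm : MeasurableSet T := measurableSet_lt measurable_const hg
  set S := {I : DyadicIntvl | c * volume (dSet I) < ∫⁻ t in dSet I, g t} with hS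
  have hset : {x | c < dMax g x} ⊆
      ⋃ s : Finset S, ⋃ I ∈ s.map (Function.Embedding.subtype _), dSet I := by
    intro x hx
    obtain ⟨I, hI⟩ := lt_iSup_iff.1 (show c < dMax g x from hx)
    by_cases hxI : x ∈ dSet I
    · rw [Set.indicator_of_mem hxI] at hI
      have : I ∈ S := by
        rw [mul_comm, ← div_eq_mul_inv] at hI
        exact (ENNReal.lt_div_iff_mul_lt (Or.inl (dSet_volume_ne_zero I))
          (Or.inl (dSet_volume_ne_top I))).1 hI
      simp only [Set.mem_iUnion]
      exact ⟨{⟨I, this⟩}, I, by simp, hxI⟩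
    · simp [hxI] at hI
  have hfin : ∀ s : Finset S,
      c / 2 * volume (⋃ I ∈ s.map (Function.Embedding.subtype _), dSet I) ≤
        ∫⁻ t in T, g t := by
    intro s
    refine (mul_volume_biUnion_dSet_le (T.indicator g) (c / 2) _ ?_).trans ?_
    · intro I hI
      have hIS : c * volume (dSet I) < ∫⁻ t in dSet I, g t := by
        obtain ⟨J, _, rfl⟩ := Finset.mem_map.1 hI
        exact J.2
      have h1 : ∫⁻ t in dSet I, g t ≤
          (∫⁻ t in dSet I, T.indicator g t) + c / 2 * volume (dSet I) := by
        rw [← setLIntegral_const, ← lintegral_add_left (hg.indicator hTm)]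
        refine lintegral_mono fun t => ?_
        by_cases ht : t ∈ T
        · simp [ht]
        · simpa [ht] using not_lt.1 ht
      have h2 : c / 2 * volume (dSet I) + c / 2 * volume (dSet I) = c * volume (dSet I) := by
        rw [← add_mul, ENNReal.add_halves]
      have h3 : c / 2 * volume (dSet I) ≠ ⊤ :=
        ENNReal.mul_ne_top (by simp [ENNReal.div_eq_top, hc]) (dSet_volume_ne_top I)
      exact (ENNReal.add_le_add_iff_right h3).1 (h2.le.trans (hIS.le.trans h1))
    · refine (setLIntegral_le_lintegral _ _).trans (le_of_eq ?_)
      rw [lintegral_indicator hTm]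
  have hdir : Directed (· ⊆ ·)
      (fun s : Finset S => ⋃ I ∈ s.map (Function.Embedding.subtype _), dSet I) := by
    refine Monotone.directed_le fun s t hst => ?_
    exact Set.biUnion_subset_biUnion_left fun J hJ => Finset.map_subset_map.2 hst hJ
  calc c * volume {x | c < dMax g x}
      ≤ c * ⨆ s : Finset S, volume (⋃ I ∈ s.map (Function.Embedding.subtype _), dSet I) := by
        gcongr
        exact (measure_mono hset).trans_eq hdir.measure_iUnion
    _ ≤ 2 * ∫⁻ t in T, g t := by
        rw [ENNReal.mul_iSup]
        refine iSup_le fun s => ?_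
        calc _ = 2 * (c / 2 * volume (⋃ I ∈ s.map (Function.Embedding.subtype _), dSet I)) := by
              rw [← mul_assoc, ENNReal.mul_div_cancel (by norm_num) (by norm_num)]
          _ ≤ _ := by
              gcongr
              exact hfin s

lemma lintegral_rpow_of_lt {s : ℝ} (hs : 0 < s) (x : ℝ≥0∞) :
    ∫⁻ t in Set.Ioi (0 : ℝ), {t : ℝ | ENNReal.ofReal t < x}.indicator
      (fun t => ENNReal.ofReal (s * t ^ (s - 1))) t = x ^ s := by
  have key : ∀ y : ℝ, 0 ≤ y →
      ∫⁻ t in Set.Ioi (0 : ℝ), {t : ℝ | ENNReal.ofReal t < ENNReal.ofReal y}.indicator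
        (fun t => ENNReal.ofReal (s * t ^ (s - 1))) t = ENNReal.ofReal y ^ s := by
    intro y hy
    have := lintegral_rpow_eq_lintegral_meas_lt_mul (Measure.dirac ()) (f := fun _ => y)
      (by filter_upwards; intro; exact hy) aemeasurable_const hs
    rw [lintegral_const, Measure.dirac_apply_of_mem (Set.mem_univ _), mul_one,
      ← ENNReal.ofReal_rpow_of_nonneg hy hs.le, ← lintegral_const_mul' _ _ ENNReal.ofReal_ne_top]
      at this
    rw [this]
    refine setLIntegral_congr_fun measurableSet_Ioi fun t ht => ?_
    by_cases h : t < y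
    · have h' : ENNReal.ofReal t < ENNReal.ofReal y :=
        (ENNReal.ofReal_lt_ofReal_iff_of_nonneg (le_of_lt ht)).2 h
      simp [h, h', ENNReal.ofReal_mul hs.le]
    · have h' : ¬ ENNReal.ofReal t < ENNReal.ofReal y := fun h' =>
        h ((ENNReal.ofReal_lt_ofReal_iff_of_nonneg (le_of_lt ht)).1 h')
      simp [h, h']
  by_cases hx : x = ⊤
  · subst hx
    rw [ENNReal.top_rpow_of_pos hs]
    refine ENNReal.eq_top_of_forall_nnreal_le fun r => ?_
    have h := key ((r : ℝ) ^ (1 / s)) (by positivity)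
    rw [ENNReal.ofReal_rpow_of_nonneg (by positivity) hs.le, ← Real.rpow_mul r.coe_nonneg,
      one_div_mul_cancel hs.ne', Real.rpow_one, ENNReal.ofReal_coe_nnreal] at h
    rw [← h]
    refine lintegral_mono fun t => ?_
    refine Set.indicator_le_indicator_of_subset (fun t ht => ?_) (fun _ => zero_le) t
    exact ENNReal.ofReal_lt_top
  · rw [← ENNReal.ofReal_toReal hx]
    exact key _ ENNReal.toReal_nonneg

/-- The `L^s` bound for the dyadic maximal function on the line. -/
lemma lintegral_dMax_rpow_le {s : ℝ} (hs : 1 < s) {g : ℝ → ℝ≥0∞} (hg : Measurable g) :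
    ∫⁻ x, dMax g x ^ s ≤
      ENNReal.ofReal (2 * s / (s - 1)) * 2 ^ (s - 1) * ∫⁻ x, g x ^ s := by
  have hs0 : 0 < s := by linarith
  have hs1 : 0 < s - 1 := by linarith
  have hm : Measurable (dMax g) := measurable_dMax g
  set w : ℝ → ℝ≥0∞ := fun t => ENNReal.ofReal (s * t ^ (s - 1)) with hw
  set v : ℝ → ℝ≥0∞ := fun t => ENNReal.ofReal (2 * s * t ^ (s - 2)) with hv
  have hwm : Measurable w := by fun_prop
  have hvm : Measurable v := by fun_prop
  calc ∫⁻ x, dMax g x ^ s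
      = ∫⁻ x, ∫⁻ t in Set.Ioi (0 : ℝ), {t : ℝ | ENNReal.ofReal t < dMax g x}.indicator w t := by
        refine lintegral_congr fun x => (lintegral_rpow_of_lt hs0 _).symm
    _ = ∫⁻ t in Set.Ioi (0 : ℝ), ∫⁻ x, {t : ℝ | ENNReal.ofReal t < dMax g x}.indicator w t := by
        apply lintegral_lintegral_swap
        have : MeasurableSet {z : ℝ × ℝ | ENNReal.ofReal z.2 < dMax g z.1} :=
          measurableSet_lt (by fun_prop) (hm.comp measurable_fst)
        exact ((hwm.comp measurable_snd).indicator this).aemeasurable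
    _ ≤ ∫⁻ t in Set.Ioi (0 : ℝ), ∫⁻ x,
          {t : ℝ | ENNReal.ofReal t < 2 * g x}.indicator (fun t => v t * g x) t := by
        refine setLIntegral_mono' measurableSet_Ioi fun t ht => ?_
        have ht : (0 : ℝ) < t := ht
        have e1 : ∫⁻ x, {t : ℝ | ENNReal.ofReal t < dMax g x}.indicator w t =
            w t * volume {x | ENNReal.ofReal t < dMax g x} := by
          rw [← lintegral_indicator_const (measurableSet_lt measurable_const hm)]
          rfl
        have e2 : {x | ENNReal.ofReal t / 2 < g x} = {x | ENNReal.ofReal t < 2 * g x} := by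
          ext x
          simp only [Set.mem_ofPred_eq]
          rw [ENNReal.div_lt_iff (by simp) (by simp), mul_comm]
        have e3 : ∫⁻ x, {t : ℝ | ENNReal.ofReal t < 2 * g x}.indicator (fun t => v t * g x) t =
            v t * ∫⁻ x in {x | ENNReal.ofReal t / 2 < g x}, g x := by
          rw [e2, ← lintegral_const_mul _ hg, ← lintegral_indicator
            (measurableSet_lt measurable_const (by fun_prop))]
          rfl
        have e4 : w t = ENNReal.ofReal (s * t ^ (s - 2)) * ENNReal.ofReal t := by
          rw [← ENNReal.ofReal_mul (by positivity), mul_assoc, ← Real.rpow_add_one ht.ne',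
            show s - 2 + 1 = s - 1 by ring]
        have e5 : v t = ENNReal.ofReal (s * t ^ (s - 2)) * 2 := by
          rw [← ENNReal.ofReal_ofNat 2, ← ENNReal.ofReal_mul (by positivity),
            show s * t ^ (s - 2) * 2 = 2 * s * t ^ (s - 2) by ring]
        rw [e1, e3, e4, e5, mul_assoc, mul_assoc]
        exact mul_le_mul' le_rfl <| mul_volume_lt_dMax_le hg ENNReal.ofReal_ne_top
    _ = ∫⁻ x, ∫⁻ t in Set.Ioi (0 : ℝ),
          {t : ℝ | ENNReal.ofReal t < 2 * g x}.indicator (fun t => v t * g x) t := by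
        apply lintegral_lintegral_swap
        have : MeasurableSet {z : ℝ × ℝ | ENNReal.ofReal z.1 < 2 * g z.2} :=
          measurableSet_lt (by fun_prop) (by fun_prop)
        have h2 : Measurable fun z : ℝ × ℝ => v z.1 * g z.2 := by fun_prop
        exact (h2.indicator this).aemeasurable
    _ = ∫⁻ x, ENNReal.ofReal (2 * s / (s - 1)) * 2 ^ (s - 1) * g x ^ s := by
        refine lintegral_congr fun x => ?_
        have hx := lintegral_rpow_of_lt hs1 (2 * g x)
        have e : ∀ t : ℝ, {t : ℝ | ENNReal.ofReal t < 2 * g x}.indicator (fun t => v t * g x) t =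
            ENNReal.ofReal (2 * s / (s - 1)) * ({t : ℝ | ENNReal.ofReal t < 2 * g x}.indicator
              (fun t => ENNReal.ofReal ((s - 1) * t ^ (s - 1 - 1))) t) * g x := by
          intro t
          by_cases ht : ENNReal.ofReal t < 2 * g x
          · simp only [Set.indicator, Set.mem_ofPred_eq, ht, if_true]
            rw [← ENNReal.ofReal_mul (by positivity), hv]
            congr 2
            rw [show s - 1 - 1 = s - 2 by ring]
            field_simp
          · simp [Set.indicator, ht]
        have hmm : Measurable ({t : ℝ | ENNReal.ofReal t < 2 * g x}.indicator
              (fun t => ENNReal.ofReal ((s - 1) * t ^ (s - 1 - 1)))) :=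
          Measurable.indicator (by fun_prop) (measurableSet_lt (by fun_prop) measurable_const)
        simp_rw [e]
        rw [lintegral_mul_const _ (hmm.const_mul _), lintegral_const_mul _ hmm, hx,
          ENNReal.mul_rpow_of_nonneg _ _ hs1.le]
        rw [rpow_eq_mul_rpow_sub_one (g x) hs.le]
        ring
    _ = _ := lintegral_const_mul _ (by fun_prop)

/-! ### The strong dyadic maximal function -/

/-- The dyadic maximal function in the second variable. -/
def vMax (g : ℝ × ℝ → ℝ≥0∞) (z : ℝ × ℝ) : ℝ≥0∞ := dMax (fun t => g (z.1, t)) z.2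

/-- The dyadic maximal function in the first variable. -/
def hMax (g : ℝ × ℝ → ℝ≥0∞) (z : ℝ × ℝ) : ℝ≥0∞ := dMax (fun t => g (t, z.2)) z.1

/-- The iterated dyadic maximal function. -/
def sMax (g : ℝ × ℝ → ℝ≥0∞) : ℝ × ℝ → ℝ≥0∞ := hMax (vMax g)

lemma measurable_vMax {g : ℝ × ℝ → ℝ≥0∞} (hg : Measurable g) : Measurable (vMax g) := by
  refine Measurable.iSup fun I => ?_
  have h1 : Measurable fun z : ℝ × ℝ =>
      (volume (dSet I))⁻¹ * ∫⁻ t in dSet I, g (z.1, t) :=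
    (hg.lintegral_prod_right'.comp measurable_fst).const_mul _
  exact h1.indicator (measurable_snd (measurableSet_dSet I))

lemma measurable_hMax {g : ℝ × ℝ → ℝ≥0∞} (hg : Measurable g) : Measurable (hMax g) :=
  (measurable_vMax (hg.comp measurable_swap)).comp measurable_swap

lemma measurable_sMax {g : ℝ × ℝ → ℝ≥0∞} (hg : Measurable g) : Measurable (sMax g) :=
  measurable_hMax (measurable_vMax hg)

/-- The `L^s` bound for the iterated dyadic maximal function. -/
lemma exists_lintegral_sMax_rpow_le {s : ℝ} (hs : 1 < s) :
    ∃ C : ℝ≥0∞, C ≠ ⊤ ∧ ∀ g : ℝ × ℝ → ℝ≥0∞, Measurable g →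
      ∫⁻ z, sMax g z ^ s ≤ C * ∫⁻ z, g z ^ s := by
  set D : ℝ≥0∞ := ENNReal.ofReal (2 * s / (s - 1)) * 2 ^ (s - 1) with hD
  have hDt : D ≠ ⊤ := ENNReal.mul_ne_top ENNReal.ofReal_ne_top
    (ENNReal.rpow_ne_top_of_nonneg (by linarith) (by norm_num))
  have hv : ∀ g : ℝ × ℝ → ℝ≥0∞, Measurable g → ∫⁻ z, vMax g z ^ s ≤ D * ∫⁻ z, g z ^ s := by
    intro g hg
    rw [Measure.volume_eq_prod, lintegral_prod _ ((measurable_vMax hg).pow_const s).aemeasurable,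
      lintegral_prod _ (hg.pow_const s).aemeasurable, ← lintegral_const_mul' _ _ hDt]
    exact lintegral_mono fun x => lintegral_dMax_rpow_le hs (hg.comp measurable_prodMk_left)
  have hswap : ∀ g : ℝ × ℝ → ℝ≥0∞, ∫⁻ z : ℝ × ℝ, g z.swap = ∫⁻ z, g z := by
    intro g
    exact lintegral_prod_swap g
  have hh : ∀ g : ℝ × ℝ → ℝ≥0∞, Measurable g → ∫⁻ z, hMax g z ^ s ≤ D * ∫⁻ z, g z ^ s := by
    intro g hg
    calc ∫⁻ z, hMax g z ^ s = ∫⁻ z, vMax (g ∘ Prod.swap) z ^ s :=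
          hswap fun z => vMax (g ∘ Prod.swap) z ^ s
      _ ≤ D * ∫⁻ z, (g ∘ Prod.swap) z ^ s := hv _ (hg.comp measurable_swap)
      _ = D * ∫⁻ z, g z ^ s := by
        congr 1
        exact hswap fun z => g z ^ s
  refine ⟨D * D, ENNReal.mul_ne_top hDt hDt, fun g hg => ?_⟩
  calc ∫⁻ z, sMax g z ^ s ≤ D * ∫⁻ z, vMax g z ^ s := hh _ (measurable_vMax hg)
    _ ≤ D * (D * ∫⁻ z, g z ^ s) := by
        gcongr
        exact hv g hg
    _ = _ := (mul_assoc _ _ _).symm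

/-! ### Dyadic rectangles -/

lemma measurableSet_rSet (R : DyadicRect) : MeasurableSet (rSet R) :=
  (measurableSet_dSet _).prod (measurableSet_dSet _)

lemma rSet_volume (R : DyadicRect) :
    volume (rSet R) = volume (dSet R.1) * volume (dSet R.2) := by
  rw [rSet, Measure.volume_eq_prod, Measure.prod_prod]

lemma rSet_volume_ne_zero (R : DyadicRect) : volume (rSet R) ≠ 0 := by
  rw [rSet_volume]
  exact mul_ne_zero (dSet_volume_ne_zero _) (dSet_volume_ne_zero _)

lemma rSet_volume_ne_top (R : DyadicRect) : volume (rSet R) ≠ ⊤ := by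
  rw [rSet_volume]
  exact ENNReal.mul_ne_top (dSet_volume_ne_top _) (dSet_volume_ne_top _)

lemma average_rSet_le_sMax {g : ℝ × ℝ → ℝ≥0∞} (hg : Measurable g) {R : DyadicRect}
    {z : ℝ × ℝ} (hz : z ∈ rSet R) :
    (volume (rSet R))⁻¹ * ∫⁻ w in rSet R, g w ≤ sMax g z := by
  calc (volume (rSet R))⁻¹ * ∫⁻ w in rSet R, g w
      = (volume (dSet R.1))⁻¹ * ∫⁻ x in dSet R.1,
          (volume (dSet R.2))⁻¹ * ∫⁻ y in dSet R.2, g (x, y) := by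
        rw [lintegral_const_mul _ hg.lintegral_prod_right', ← mul_assoc, rSet_volume,
          ENNReal.mul_inv (Or.inl (dSet_volume_ne_zero _)) (Or.inl (dSet_volume_ne_top _)),
          rSet, Measure.volume_eq_prod, ← Measure.prod_restrict,
          lintegral_prod _ hg.aemeasurable]
    _ ≤ (volume (dSet R.1))⁻¹ * ∫⁻ x in dSet R.1, vMax g (x, z.2) := by
        gcongr with x
        exact inv_mul_lintegral_le_dMax (fun y => g (x, y)) hz.2
    _ ≤ sMax g z := inv_mul_lintegral_le_dMax (fun x => vMax g (x, z.2)) hz.1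

lemma lintegral_rSet_le_of_mem {g : ℝ × ℝ → ℝ≥0∞} (hg : Measurable g) {R : DyadicRect}
    {z : ℝ × ℝ} (hz : z ∈ rSet R) :
    ∫⁻ w in rSet R, g w ≤ sMax g z * volume (rSet R) := by
  have h := average_rSet_le_sMax hg hz
  rw [mul_comm, ← div_eq_mul_inv] at h
  exact (ENNReal.div_le_iff (rSet_volume_ne_zero R) (rSet_volume_ne_top R)).1 h

/-! ### Carleson mass of finite families -/

open Classical in
/-- The Carleson mass of the rectangles of `s` contained in `U`. -/
def mass (b : DyadicRect → ℝ≥0∞) (s : Finset DyadicRect) (U : Set (ℝ × ℝ)) : ℝ≥0∞ :=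
  ∑ R ∈ s with rSet R ⊆ U, b R * volume (rSet R)

open Classical in
/-- The part of `F_U` coming from the rectangles of `s`. -/
def finFU (b : DyadicRect → ℝ≥0∞) (s : Finset DyadicRect) (U : Set (ℝ × ℝ)) (x : ℝ × ℝ) :
    ℝ≥0∞ :=
  ∑ R ∈ s with rSet R ⊆ U, b R * Set.indicator (rSet R) (fun _ => (1 : ℝ≥0∞)) x

lemma measurable_finFU (b : DyadicRect → ℝ≥0∞) (s : Finset DyadicRect) (U : Set (ℝ × ℝ)) :
    Measurable (finFU b s U) :=
  Finset.measurable_fun_sum _ fun R _ =>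
    (measurable_const.indicator (measurableSet_rSet R)).const_mul _

lemma FU_eq_iSup (a : DyadicRect → ℝ) (U : Set (ℝ × ℝ)) (x : ℝ × ℝ) :
    FU a U x = ⨆ s, finFU (fun R => ENNReal.ofReal (a R)) s U x := by
  classical
  have h := tsum_subtype {R : DyadicRect | rSet R ⊆ U}
    (fun R => ENNReal.ofReal (a R) * Set.indicator (rSet R) (fun _ => (1 : ℝ≥0∞)) x)
  refine Eq.trans h ?_
  rw [ENNReal.tsum_eq_iSup_sum]
  congr 1
  ext s
  rw [finFU, Finset.sum_filter]
  rfl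

lemma finFU_le_FU (a : DyadicRect → ℝ) (s : Finset DyadicRect) (U : Set (ℝ × ℝ)) (x : ℝ × ℝ) :
    finFU (fun R => ENNReal.ofReal (a R)) s U x ≤ FU a U x := by
  rw [FU_eq_iSup]
  exact le_iSup (fun s => finFU (fun R => ENNReal.ofReal (a R)) s U x) s

lemma finFU_mono (b : DyadicRect → ℝ≥0∞) (U : Set (ℝ × ℝ)) (x : ℝ × ℝ) :
    Monotone fun s => finFU b s U x := by
  classical
  exact fun _ _ hst => Finset.sum_le_sum_of_subset (Finset.filter_subset_filter _ hst)

lemma measurable_FU (a : DyadicRect → ℝ) (U : Set (ℝ × ℝ)) : Measurable (FU a U) := by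
  rw [show FU a U = fun x => ⨆ s, finFU (fun R => ENNReal.ofReal (a R)) s U x from
    funext (FU_eq_iSup a U)]
  exact Measurable.iSup fun s => measurable_finFU _ s U

lemma finFU_eq_zero_of_notMem (b : DyadicRect → ℝ≥0∞) (s : Finset DyadicRect)
    {U : Set (ℝ × ℝ)} {x : ℝ × ℝ} (hx : x ∉ U) : finFU b s U x = 0 := by
  classical
  refine Finset.sum_eq_zero fun R hR => ?_
  have : x ∉ rSet R := fun h => hx ((Finset.mem_filter.1 hR).2 h)
  simp [this]

lemma FU_eq_zero_of_notMem (a : DyadicRect → ℝ) {U : Set (ℝ × ℝ)} {x : ℝ × ℝ} (hx : x ∉ U) :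
    FU a U x = 0 := by
  rw [FU_eq_iSup]
  simp [finFU_eq_zero_of_notMem _ _ hx]

lemma lintegral_finFU_mul (b : DyadicRect → ℝ≥0∞) (s : Finset DyadicRect) (U : Set (ℝ × ℝ))
    {g : ℝ × ℝ → ℝ≥0∞} (hg : Measurable g) :
    open Classical in
    ∫⁻ z, finFU b s U z * g z = ∑ R ∈ s with rSet R ⊆ U, b R * ∫⁻ z in rSet R, g z := by
  classical
  simp_rw [finFU, Finset.sum_mul]
  have hm : ∀ R : DyadicRect, Measurable (fun z =>
      b R * Set.indicator (rSet R) (fun _ => (1 : ℝ≥0∞)) z * g z) := fun R =>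
    ((measurable_const.indicator (measurableSet_rSet R)).const_mul _).mul hg
  rw [lintegral_finsetSum _ fun R _ => hm R]
  refine Finset.sum_congr rfl fun R _ => ?_
  simp_rw [mul_assoc]
  have hRm : Measurable fun z => Set.indicator (rSet R) (fun _ => (1 : ℝ≥0∞)) z * g z :=
    (measurable_const.indicator (measurableSet_rSet R)).mul hg
  rw [lintegral_const_mul _ hRm, ← lintegral_indicator (measurableSet_rSet R)]
  congr 2
  ext z
  by_cases hz : z ∈ rSet R <;> simp [hz]

/-- A Carleson bound on open sets bounds the mass of rectangles lying in a measurable set. -/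
lemma mass_le_of_subset {b : DyadicRect → ℝ≥0∞} {N : ℝ≥0∞} (hN0 : N ≠ 0) (hN : N ≠ ⊤)
    (hb : ∀ (s : Finset DyadicRect) (U : Set (ℝ × ℝ)), IsOpen U → volume U < ⊤ →
      mass b s U ≤ N * volume U)
    (s : Finset DyadicRect) (W : Set (ℝ × ℝ)) : mass b s W ≤ N * volume W := by
  classical
  rw [mul_comm, ← ENNReal.div_le_iff hN0 hN]
  refine le_of_forall_gt fun r hr => ?_
  obtain ⟨O, hWO, hO, hOr⟩ := W.exists_isOpen_lt_of_lt r hr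
  refine lt_of_le_of_lt ?_ hOr
  rw [ENNReal.div_le_iff hN0 hN, mul_comm]
  refine le_trans ?_ (hb s O hO (hOr.trans_le le_top))
  refine Finset.sum_le_sum_of_subset fun R hR => ?_
  rw [Finset.mem_filter] at hR ⊢
  exact ⟨hR.1, hR.2.trans hWO⟩

lemma lintegral_Ioi_of_lt (x : ℝ≥0∞) :
    ∫⁻ t in Set.Ioi (0 : ℝ), {t : ℝ | ENNReal.ofReal t < x}.indicator (fun _ => 1) t = x := by
  have h := lintegral_rpow_of_lt one_pos x
  simpa using h

/-- The dyadic Carleson embedding on the bidisk. -/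
lemma lintegral_finFU_mul_le {b : DyadicRect → ℝ≥0∞} {N : ℝ≥0∞} (hN0 : N ≠ 0) (hN : N ≠ ⊤)
    (hb : ∀ (s : Finset DyadicRect) (U : Set (ℝ × ℝ)), IsOpen U → volume U < ⊤ →
      mass b s U ≤ N * volume U)
    (s : Finset DyadicRect) (U : Set (ℝ × ℝ)) {g : ℝ × ℝ → ℝ≥0∞} (hg : Measurable g) :
    ∫⁻ z, finFU b s U z * g z ≤ N * ∫⁻ z in U, sMax g z := by
  classical
  have hM := measurable_sMax hg
  set m : DyadicRect → ℝ≥0∞ := fun R => (volume (rSet R))⁻¹ * ∫⁻ z in rSet R, g z with hm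
  have hind : ∀ x : ℝ≥0∞, Measurable
      ({t : ℝ | ENNReal.ofReal t < x}.indicator (fun _ => (1 : ℝ≥0∞))) := fun x =>
    measurable_const.indicator (measurableSet_lt (by fun_prop) measurable_const)
  calc ∫⁻ z, finFU b s U z * g z
      = ∑ R ∈ s with rSet R ⊆ U, b R * ∫⁻ z in rSet R, g z := lintegral_finFU_mul b s U hg
    _ = ∑ R ∈ s with rSet R ⊆ U, ∫⁻ t in Set.Ioi (0 : ℝ),
          b R * volume (rSet R) *
            {t : ℝ | ENNReal.ofReal t < m R}.indicator (fun _ => 1) t := by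
        refine Finset.sum_congr rfl fun R _ => ?_
        rw [lintegral_const_mul _ (hind _), lintegral_Ioi_of_lt, hm, mul_assoc, ← mul_assoc _ _⁻¹,
          ENNReal.mul_inv_cancel (rSet_volume_ne_zero R) (rSet_volume_ne_top R), one_mul]
    _ = ∫⁻ t in Set.Ioi (0 : ℝ), ∑ R ∈ s with rSet R ⊆ U,
          b R * volume (rSet R) *
            {t : ℝ | ENNReal.ofReal t < m R}.indicator (fun _ => 1) t :=
        (lintegral_finsetSum _ fun R _ => (hind _).const_mul _).symm
    _ ≤ ∫⁻ t in Set.Ioi (0 : ℝ), N * ∫⁻ z in U,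
          {t : ℝ | ENNReal.ofReal t < sMax g z}.indicator (fun _ => 1) t := by
        refine lintegral_mono fun t => ?_
        set W := {z | ENNReal.ofReal t < sMax g z} with hW
        have hWm : MeasurableSet W := measurableSet_lt measurable_const hM
        have e1 : ∫⁻ z in U, {t : ℝ | ENNReal.ofReal t < sMax g z}.indicator
            (fun _ => (1 : ℝ≥0∞)) t = volume (W ∩ U) := by
          rw [← Measure.restrict_apply hWm, ← lintegral_indicator_one hWm]
          rfl
        rw [e1]
        refine le_trans ?_ (mass_le_of_subset hN0 hN hb s (W ∩ U))
        rw [mass, Finset.sum_filter, Finset.sum_filter]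
        refine Finset.sum_le_sum fun R _ => ?_
        by_cases hRU : rSet R ⊆ U
        · by_cases ht : ENNReal.ofReal t < m R
          · have hRW : rSet R ⊆ W ∩ U := fun z hz =>
              ⟨ht.trans_le (average_rSet_le_sMax hg hz), hRU hz⟩
            simp [hRU, hRW, Set.indicator, ht]
          · simp [Set.indicator, ht]
        · simp [hRU]
    _ = N * ∫⁻ z in U, ∫⁻ t in Set.Ioi (0 : ℝ),
          {t : ℝ | ENNReal.ofReal t < sMax g z}.indicator (fun _ => 1) t := by
        rw [lintegral_const_mul' _ _ hN]
        congr 1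
        apply lintegral_lintegral_swap
        have : MeasurableSet {z : ℝ × (ℝ × ℝ) | ENNReal.ofReal z.1 < sMax g z.2} :=
          measurableSet_lt (by fun_prop) (hM.comp measurable_snd)
        have h1 : Measurable fun _ : ℝ × (ℝ × ℝ) => (1 : ℝ≥0∞) := measurable_const
        exact (h1.indicator this).aemeasurable
    _ = N * ∫⁻ z in U, sMax g z := by simp_rw [lintegral_Ioi_of_lt]

/-- A Carleson mass bound controls the `L^r` norms of `F_U`, `1 < r < ∞`. -/
lemma exists_lintegral_FU_rpow_le {r : ℝ} (hr : 1 < r) :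
    ∃ C : ℝ≥0∞, C ≠ ⊤ ∧ ∀ (a : DyadicRect → ℝ) (N : ℝ≥0∞), N ≠ 0 → N ≠ ⊤ →
      (∀ (s : Finset DyadicRect) (U : Set (ℝ × ℝ)), IsOpen U → volume U < ⊤ →
        mass (fun R => ENNReal.ofReal (a R)) s U ≤ N * volume U) →
      ∀ U : Set (ℝ × ℝ), IsOpen U → volume U < ⊤ →
        ∫⁻ x, FU a U x ^ r ≤ (C * N) ^ r * volume U := by
  have hr0 : 0 < r := by linarith
  have hr1 : 0 < r - 1 := by linarith
  set r' := r / (r - 1) with hr'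
  have hconj : r.HolderConjugate r' := Real.HolderConjugate.conjExponent hr
  have hr'1 : 1 < r' := hconj.symm.lt
  obtain ⟨C, hC, hmax⟩ := exists_lintegral_sMax_rpow_le hr'1
  refine ⟨C ^ (1 / r'), ENNReal.rpow_ne_top_of_nonneg (by positivity) hC, ?_⟩
  intro a N hN0 hN hb U hU hUt
  set b : DyadicRect → ℝ≥0∞ := fun R => ENNReal.ofReal (a R) with hbdef
  have hfin : ∀ s, ∫⁻ x, finFU b s U x ^ r ≤ (C ^ (1 / r') * N) ^ r * volume U := by
    intro s
    set X := ∫⁻ x, finFU b s U x ^ r with hX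
    have hXt : X ≠ ⊤ := by
      have hB : ∑ R ∈ s, b R ≠ ⊤ := by
        simp [hbdef]
      have h1 : X ≤ ∫⁻ x in U, (∑ R ∈ s, b R) ^ r := by
        rw [← lintegral_indicator hU.measurableSet]
        refine lintegral_mono fun x => ?_
        by_cases hx : x ∈ U
        · rw [Set.indicator_of_mem hx]
          refine ENNReal.rpow_le_rpow ?_ hr0.le
          classical
          refine (Finset.sum_le_sum_of_subset (Finset.filter_subset _ _)).trans ?_
          refine Finset.sum_le_sum fun R _ => ?_
          by_cases hxR : x ∈ rSet R <;> simp [hxR]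
        · simp [finFU_eq_zero_of_notMem b s hx, hr0]
      rw [setLIntegral_const] at h1
      exact ne_top_of_le_ne_top
        (ENNReal.mul_ne_top (ENNReal.rpow_ne_top_of_nonneg hr0.le hB) hUt.ne) h1
    set g : ℝ × ℝ → ℝ≥0∞ := fun x => finFU b s U x ^ (r - 1) with hg
    have hgm : Measurable g := (measurable_finFU b s U).pow_const _
    have hgr : ∀ x, g x ^ r' = finFU b s U x ^ r := by
      intro x
      rw [hg, ← ENNReal.rpow_mul, hr', mul_div_cancel₀ _ hr1.ne']
    have h1 : X ≤ N * ∫⁻ z in U, sMax g z := by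
      refine le_trans (le_of_eq ?_)
        (lintegral_finFU_mul_le hN0 hN hb s U hgm)
      exact lintegral_congr fun x => rpow_eq_mul_rpow_sub_one _ hr.le
    have h2 : ∫⁻ z in U, sMax g z ≤ volume U ^ (1 / r) * (C * X) ^ (1 / r') := by
      have := ENNReal.lintegral_mul_le_Lp_mul_Lq (volume.restrict U) hconj
        (f := fun _ => 1) (g := sMax g) aemeasurable_const (measurable_sMax hgm).aemeasurable
      simp only [Pi.mul_apply, one_mul, ENNReal.one_rpow, lintegral_const,
        Measure.restrict_apply MeasurableSet.univ, Set.univ_inter] at this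
      refine this.trans ?_
      gcongr
      refine (setLIntegral_le_lintegral _ _).trans ((hmax g hgm).trans_eq ?_)
      simp_rw [hgr]
      rfl
    by_cases hX0 : X = 0
    · rw [hX0]
      exact zero_le
    have hr's : 1 / r + 1 / r' = 1 := by simpa using hconj.inv_add_inv_eq_one
    have hY0 : X ^ (1 / r') ≠ 0 := by
      simp [ENNReal.rpow_eq_zero_iff, hX0, hXt]
    have hYt : X ^ (1 / r') ≠ ⊤ := ENNReal.rpow_ne_top_of_nonneg (by positivity) hXt
    have h3 : X ^ (1 / r) ≤ C ^ (1 / r') * N * volume U ^ (1 / r) := by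
      refine (ENNReal.mul_le_mul_iff_left hY0 hYt).1 ?_
      calc X ^ (1 / r) * X ^ (1 / r') = X := by
            rw [← ENNReal.rpow_add _ _ hX0 hXt, hr's, ENNReal.rpow_one]
        _ ≤ N * (volume U ^ (1 / r) * (C * X) ^ (1 / r')) := h1.trans (by gcongr)
        _ = _ := by
          rw [ENNReal.mul_rpow_of_nonneg _ _ (by positivity)]
          ring
    calc X = (X ^ (1 / r)) ^ r := by
          rw [← ENNReal.rpow_mul, one_div_mul_cancel hr0.ne', ENNReal.rpow_one]
      _ ≤ (C ^ (1 / r') * N * volume U ^ (1 / r)) ^ r := by gcongr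
      _ = _ := by
        rw [ENNReal.mul_rpow_of_nonneg _ _ hr0.le, ← ENNReal.rpow_mul (volume U),
          one_div_mul_cancel hr0.ne', ENNReal.rpow_one]
  have hsup : ∀ x, FU a U x ^ r = ⨆ s, finFU b s U x ^ r := by
    intro x
    rw [FU_eq_iSup]
    exact (ENNReal.orderIsoRpow r hr0).map_iSup _
  simp_rw [hsup]
  rw [lintegral_iSup_directed (fun s => ((measurable_finFU b s U).pow_const r).aemeasurable)
    (Monotone.directed_le fun s t hst x => ENNReal.rpow_le_rpow (finFU_mono b U x hst) hr0.le)]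
  exact iSup_le hfin

lemma lintegral_finFU (b : DyadicRect → ℝ≥0∞) (s : Finset DyadicRect) (U : Set (ℝ × ℝ))
    {A : Set (ℝ × ℝ)} (hA : MeasurableSet A) :
    open Classical in
    ∫⁻ z in A, finFU b s U z = ∑ R ∈ s with rSet R ⊆ U, b R * volume (rSet R ∩ A) := by
  have h := lintegral_finFU_mul b s U (measurable_const.indicator hA (f := fun _ => 1))
  rw [← lintegral_indicator hA]
  refine Eq.trans (lintegral_congr fun z => ?_) (h.trans (Finset.sum_congr rfl fun R _ => ?_))
  · by_cases hz : z ∈ A <;> simp [hz]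
  · congr 1
    rw [lintegral_indicator hA, lintegral_one, Measure.restrict_apply MeasurableSet.univ,
      Measure.restrict_apply (MeasurableSet.univ.inter hA), Set.univ_inter, Set.inter_comm]

/-- Rectangles outside of the set where `sMax 1_E > 1/2` carry little mass if `F_U` is small
off `E`. -/
lemma mass_le_add_mass (a : DyadicRect → ℝ) (s : Finset DyadicRect) {U V : Set (ℝ × ℝ)}
    {L : ℝ≥0∞}
    (hV : {z | 2⁻¹ < sMax ({x | L < FU a U x}.indicator fun _ => 1) z} ⊆ V) :
    mass (fun R => ENNReal.ofReal (a R)) s U ≤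
      2 * L * volume U + mass (fun R => ENNReal.ofReal (a R)) s V := by
  classical
  set b : DyadicRect → ℝ≥0∞ := fun R => ENNReal.ofReal (a R) with hb
  set E := {x | L < FU a U x} with hE
  have hEm : MeasurableSet E := measurableSet_lt measurable_const (measurable_FU a U)
  have hind : Measurable (E.indicator fun _ => (1 : ℝ≥0∞)) := measurable_const.indicator hEm
  have hhalf : ∀ R, ¬ rSet R ⊆ V → volume (rSet R) ≤ 2 * volume (rSet R ∩ Eᶜ) := by
    intro R hR
    obtain ⟨z, hzR, hzV⟩ := Set.not_subset.1 hR
    have hz : sMax (E.indicator fun _ => 1) z ≤ 2⁻¹ := not_lt.1 fun h => hzV (hV h)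
    have h1 : volume (rSet R ∩ E) ≤ 2⁻¹ * volume (rSet R) := by
      refine le_trans (le_of_eq ?_)
        ((lintegral_rSet_le_of_mem hind hzR).trans (by gcongr))
      rw [lintegral_indicator hEm, lintegral_one, Measure.restrict_apply MeasurableSet.univ,
        Measure.restrict_apply (MeasurableSet.univ.inter hEm), Set.univ_inter, Set.inter_comm]
    have h2 : volume (rSet R) = volume (rSet R ∩ E) + volume (rSet R ∩ Eᶜ) :=
      (measure_inter_add_sdiff (rSet R) hEm).symm
    have h3 : 2⁻¹ * volume (rSet R) + 2⁻¹ * volume (rSet R) = volume (rSet R) := by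
      rw [← add_mul, ENNReal.inv_two_add_inv_two, one_mul]
    have h4 : 2⁻¹ * volume (rSet R) ≠ ⊤ :=
      ENNReal.mul_ne_top (by simp) (rSet_volume_ne_top R)
    have h5 : 2⁻¹ * volume (rSet R) ≤ volume (rSet R ∩ Eᶜ) := by
      refine (ENNReal.add_le_add_iff_left h4).1 ?_
      rw [h3]
      exact h2.le.trans (by gcongr)
    calc volume (rSet R) = 2 * (2⁻¹ * volume (rSet R)) := by
          rw [← mul_assoc, ENNReal.mul_inv_cancel (by simp) (by simp), one_mul]
      _ ≤ _ := by gcongr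
  have hsmall : ∫⁻ z in Eᶜ, finFU b s U z ≤ L * volume U := by
    rw [← lintegral_indicator hEm.compl]
    calc ∫⁻ z, Eᶜ.indicator (finFU b s U) z
        ≤ ∫⁻ z, (toMeasurable volume U).indicator (fun _ => L) z := by
          refine lintegral_mono fun z => ?_
          by_cases hzU : z ∈ U
          · rw [Set.indicator_of_mem (subset_toMeasurable volume U hzU)]
            by_cases hzE : z ∈ E
            · simp [hzE]
            · rw [Set.indicator_of_mem hzE]
              exact (finFU_le_FU a s U z).trans (not_lt.1 hzE)
          · simp [Set.indicator, finFU_eq_zero_of_notMem b s hzU]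
      _ = L * volume U := by
        rw [lintegral_indicator_const (measurableSet_toMeasurable _ _), measure_toMeasurable]
  calc mass b s U
      ≤ (∑ R ∈ s with rSet R ⊆ U, 2 * (b R * volume (rSet R ∩ Eᶜ))) + mass b s V := by
        rw [mass, mass, Finset.sum_filter, Finset.sum_filter, Finset.sum_filter,
          ← Finset.sum_add_distrib]
        refine Finset.sum_le_sum fun R _ => ?_
        by_cases hRU : rSet R ⊆ U
        · by_cases hRV : rSet R ⊆ V
          · simp [hRU, hRV]
          · simp only [hRU, hRV, if_true, if_false, add_zero]
            rw [mul_left_comm]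
            gcongr
            exact hhalf R hRV
        · simp [hRU]
    _ ≤ 2 * L * volume U + mass b s V := by
        rw [← Finset.mul_sum, ← lintegral_finFU b s U hEm.compl, mul_assoc]
        gcongr

/-- An `L^q` Carleson bound, for any `q > 0`, controls the Carleson mass. -/
lemma exists_mass_le {q : ℝ} (hq : 0 < q) :
    ∃ K : ℝ≥0∞, K ≠ ⊤ ∧ ∀ (a : DyadicRect → ℝ) (N : ℝ≥0∞), N ≠ 0 → N ≠ ⊤ →
      (∀ U : Set (ℝ × ℝ), IsOpen U → 0 < volume U → volume U < ⊤ →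
        ∫⁻ x, FU a U x ^ q ≤ N ^ q * volume U) →
      ∀ (s : Finset DyadicRect) (U : Set (ℝ × ℝ)), IsOpen U → volume U < ⊤ →
        mass (fun R => ENNReal.ofReal (a R)) s U ≤ K * N * volume U := by
  classical
  obtain ⟨C, hC, hmax⟩ := exists_lintegral_sMax_rpow_le one_lt_two
  have hD : 16 * C + 1 ≠ ⊤ := by finiteness
  set κ := (16 * C + 1) ^ (1 / q) with hκ
  have hκt : κ ≠ ⊤ := ENNReal.rpow_ne_top_of_nonneg (by positivity) hD
  have hκq : κ ^ q = 16 * C + 1 := by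
    rw [hκ, ← ENNReal.rpow_mul, one_div_mul_cancel hq.ne', ENNReal.rpow_one]
  refine ⟨4 * κ, by finiteness, ?_⟩
  intro a N hN0 hN hU s
  set b : DyadicRect → ℝ≥0∞ := fun R => ENNReal.ofReal (a R) with hb
  have hstep : ∀ U : Set (ℝ × ℝ), IsOpen U → 0 < volume U → volume U < ⊤ →
      ∃ V : Set (ℝ × ℝ), IsOpen V ∧ volume V < volume U / 2 ∧
        mass b s U ≤ 2 * (κ * N) * volume U + mass b s V := by
    intro U hUo hU0 hUt
    set E := {x | κ * N < FU a U x} with hE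
    have hEm : MeasurableSet E := measurableSet_lt measurable_const (measurable_FU a U)
    have hind : Measurable (E.indicator fun _ => (1 : ℝ≥0∞)) := measurable_const.indicator hEm
    have hM := measurable_sMax hind
    have h1 : (16 * C + 1) * volume E ≤ volume U := by
      have hNq0 : N ^ q ≠ 0 := by simp [ENNReal.rpow_eq_zero_iff, hN0, hN]
      have hNqt : N ^ q ≠ ⊤ := ENNReal.rpow_ne_top_of_nonneg hq.le hN
      refine (ENNReal.mul_le_mul_iff_right hNq0 hNqt).1 ?_
      calc N ^ q * ((16 * C + 1) * volume E) = (κ * N) ^ q * volume E := by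
            rw [ENNReal.mul_rpow_of_nonneg _ _ hq.le, hκq]
            ring
        _ ≤ (κ * N) ^ q * volume {x | (κ * N) ^ q ≤ FU a U x ^ q} := by
            gcongr
            intro x hx
            exact ENNReal.rpow_le_rpow (le_of_lt hx) hq.le
        _ ≤ ∫⁻ x, FU a U x ^ q :=
            mul_meas_ge_le_lintegral₀ ((measurable_FU a U).pow_const q).aemeasurable _
        _ ≤ _ := hU U hUo hU0 hUt
    set W := {z | 2⁻¹ < sMax (E.indicator fun _ => 1) z} with hW
    have h2 : volume W ≤ 4 * (C * volume E) := by
      have h3 : (2⁻¹ : ℝ≥0∞) ^ (2 : ℝ) * volume W ≤ C * volume E := by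
        calc (2⁻¹ : ℝ≥0∞) ^ (2 : ℝ) * volume W
            ≤ (2⁻¹ : ℝ≥0∞) ^ (2 : ℝ) * volume {z | (2⁻¹ : ℝ≥0∞) ^ (2 : ℝ) ≤
                sMax (E.indicator fun _ => 1) z ^ (2 : ℝ)} := by
              gcongr
              intro x hx
              exact ENNReal.rpow_le_rpow (le_of_lt hx) zero_le_two
          _ ≤ ∫⁻ z, sMax (E.indicator fun _ => 1) z ^ (2 : ℝ) :=
              mul_meas_ge_le_lintegral₀ (hM.pow_const _).aemeasurable _
          _ ≤ C * ∫⁻ z, E.indicator (fun _ => (1 : ℝ≥0∞)) z ^ (2 : ℝ) := hmax _ hind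
          _ = C * volume E := by
              rw [← lintegral_indicator_one hEm]
              congr 2
              ext z
              by_cases hz : z ∈ E <;> simp [hz]
      have h4 : (4 : ℝ≥0∞) * (2⁻¹ : ℝ≥0∞) ^ (2 : ℝ) = 1 := by
        rw [ENNReal.inv_rpow, show (2 : ℝ≥0∞) ^ (2 : ℝ) = 4 by norm_num]
        exact ENNReal.mul_inv_cancel (by simp) (by simp)
      calc volume W = 4 * ((2⁻¹ : ℝ≥0∞) ^ (2 : ℝ) * volume W) := by
            rw [← mul_assoc, h4, one_mul]
        _ ≤ _ := by gcongr
    have h5 : volume W < volume U / 2 := by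
      have h6 : 4 * volume W ≤ volume U :=
        calc 4 * volume W ≤ 4 * (4 * (C * volume E)) := by gcongr
          _ = 16 * C * volume E := by ring
          _ ≤ (16 * C + 1) * volume E := by
              gcongr
              exact le_self_add
          _ ≤ volume U := h1
      have hWt : volume W ≠ ⊤ := fun h => by
        rw [h] at h6
        exact hUt.ne (top_le_iff.1 (le_trans (by simp) h6))
      rw [ENNReal.lt_div_iff_mul_lt (by simp) (by simp)]
      by_cases hW0 : volume W = 0
      · simpa [hW0] using hU0
      · refine lt_of_lt_of_le ?_ h6
        rw [mul_comm]
        exact ENNReal.mul_lt_mul_left hW0 hWt (by norm_num)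
    obtain ⟨V, hWV, hVo, hV⟩ := W.exists_isOpen_lt_of_lt _ h5
    exact ⟨V, hVo, hV, mass_le_add_mass a s hWV⟩
  obtain ⟨δ, hδ0, hδ⟩ : ∃ δ : ℝ≥0∞, δ ≠ 0 ∧ ∀ R ∈ s, δ ≤ volume (rSet R) := by
    rcases s.eq_empty_or_nonempty with rfl | hne
    · exact ⟨1, by simp⟩
    · obtain ⟨R, _, hR⟩ := s.exists_min_image (fun R => volume (rSet R)) hne
      exact ⟨volume (rSet R), rSet_volume_ne_zero R, hR⟩
  have hmain : ∀ (n : ℕ) (U : Set (ℝ × ℝ)), IsOpen U → volume U < ⊤ → volume U < 2 ^ n * δ →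
      mass b s U ≤ 4 * κ * N * volume U := by
    intro n
    induction n with
    | zero =>
      intro U _ _ hUδ
      rw [pow_zero, one_mul] at hUδ
      refine (le_of_eq (Finset.sum_eq_zero fun R hR => ?_)).trans zero_le
      rw [Finset.mem_filter] at hR
      exact absurd ((hδ R hR.1).trans (measure_mono hR.2)) (not_le.2 hUδ)
    | succ n ih =>
      intro U hUo hUt hUδ
      rcases (zero_le (a := volume U)).eq_or_lt with h0 | h0
      · refine (le_of_eq (Finset.sum_eq_zero fun R hR => ?_)).trans zero_le
        rw [Finset.mem_filter] at hR
        exact absurd (measure_mono_null hR.2 h0.symm) (rSet_volume_ne_zero R)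
      · obtain ⟨V, hVo, hV, hm⟩ := hstep U hUo h0 hUt
        have hV2 : volume U / 2 ≤ 2 ^ n * δ := by
          rw [ENNReal.div_le_iff (by simp) (by simp)]
          refine hUδ.le.trans_eq ?_
          ring
        have hVt : volume V < ⊤ := hV.trans_le le_top
        calc mass b s U ≤ 2 * (κ * N) * volume U + 4 * κ * N * (volume U / 2) := by
              refine hm.trans ?_
              gcongr
              exact (ih V hVo hVt (hV.trans_le hV2)).trans (by gcongr)
          _ = 2 * (κ * N) * volume U + 2 * (κ * N) * (2 * (volume U / 2)) := by ring
          _ = 4 * κ * N * volume U := by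
              rw [ENNReal.mul_div_cancel (by simp) (by simp)]
              ring
  intro U hUo hUt
  obtain ⟨n, hn⟩ : ∃ n : ℕ, volume U < 2 ^ n * δ := by
    obtain ⟨n, hn⟩ := ENNReal.exists_nat_mul_gt hδ0 hUt.ne
    refine ⟨n, hn.trans_le ?_⟩
    gcongr
    exact_mod_cast n.lt_two_pow_self.le
  exact hmain n U hUo hUt hn

lemma lintegral_FU_rpow_le_of_lt {p r : ℝ} (hp : 0 < p) (hpr : p < r) (a : DyadicRect → ℝ)
    {U : Set (ℝ × ℝ)} (hU : MeasurableSet U) (hU0 : 0 < volume U) (hUt : volume U < ⊤)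
    {B : ℝ≥0∞} (h : ∫⁻ x, FU a U x ^ r ≤ B ^ r * volume U) :
    ∫⁻ x, FU a U x ^ p ≤ B ^ p * volume U := by
  have hr : 0 < r := hp.trans hpr
  have h1 : 1 < r / p := (one_lt_div hp).2 hpr
  have hconj := Real.HolderConjugate.conjExponent h1
  set t := Real.conjExponent (r / p)
  have ht : 1 / (r / p) + 1 / t = 1 := by simpa using hconj.inv_add_inv_eq_one
  have hsupp : ∫⁻ x, FU a U x ^ p = ∫⁻ x in U, FU a U x ^ p := by
    rw [← lintegral_indicator hU]
    refine lintegral_congr fun x => ?_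
    by_cases hx : x ∈ U
    · simp [hx]
    · simp [hx, FU_eq_zero_of_notMem a hx, hp]
  have hH := ENNReal.lintegral_mul_le_Lp_mul_Lq (volume.restrict U) hconj
    (f := fun x => FU a U x ^ p) (g := fun _ => 1)
    ((measurable_FU a U).pow_const p).aemeasurable aemeasurable_const
  simp only [Pi.mul_apply, mul_one, ENNReal.one_rpow, lintegral_const, one_mul,
    Measure.restrict_apply MeasurableSet.univ, Set.univ_inter, ← ENNReal.rpow_mul,
    mul_div_cancel₀ r hp.ne'] at hH
  rw [hsupp]
  refine hH.trans ?_
  calc (∫⁻ x in U, FU a U x ^ r) ^ (1 / (r / p)) * volume U ^ (1 / t)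
      ≤ (B ^ r * volume U) ^ (1 / (r / p)) * volume U ^ (1 / t) := by
        gcongr
        exact (setLIntegral_le_lintegral _ _).trans h
    _ = B ^ p * volume U := by
        rw [ENNReal.mul_rpow_of_nonneg _ _ (by positivity), ← ENNReal.rpow_mul, mul_assoc,
          ← ENNReal.rpow_add _ _ hU0.ne' hUt.ne, ht, ENNReal.rpow_one]
        congr 2
        field_simp

lemma volume_rpow_mul_rpow_le_iff {p : ℝ} (hp : 0 < p) {v X B : ℝ≥0∞} (hv0 : v ≠ 0)
    (hv : v ≠ ⊤) : v ^ (-(1 / p)) * X ^ (1 / p) ≤ B ↔ X ≤ B ^ p * v := by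
  rw [ENNReal.rpow_neg, ← ENNReal.inv_rpow, ← ENNReal.mul_rpow_of_nonneg _ _ (by positivity),
    one_div, ENNReal.rpow_inv_le_iff hp, mul_comm, ← div_eq_mul_inv,
    ENNReal.div_le_iff hv0 hv]

/-- The John–Nirenberg inequality for Carleson measures on the bidisk: all the norms
`‖⬝‖_{CM,p}`, `0 < p < ∞`, are equivalent. -/
theorem john_nirenberg_carleson :
    ∀ p q : ℝ, 0 < p → 0 < q →
      ∃ C : ℝ, 0 < C ∧
        ∀ a : DyadicRect → ℝ, (∀ R, 0 ≤ a R) →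
          CMnorm a p ≤ ENNReal.ofReal C * CMnorm a q := by

  intro p q hp hq
  obtain ⟨K, hK, hmass⟩ := exists_mass_le hq
  obtain ⟨C, hC, hFU⟩ := exists_lintegral_FU_rpow_le (lt_add_of_pos_left 1 hp)
  -- The added `1` keeps the constants positive.
  set D : ℝ≥0∞ := C * (K + 1) + 1 with hD
  have hDt : D ≠ ⊤ := by finiteness
  refine ⟨D.toReal, ENNReal.toReal_pos (by simp [hD]) hDt, fun a _ => ?_⟩
  rw [ENNReal.ofReal_toReal hDt]
  suffices h : ∀ N : ℝ≥0∞, CMnorm a q < N → N ≠ ⊤ → CMnorm a p ≤ D * N by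
    rw [mul_comm, ← ENNReal.div_le_iff (by simp [hD]) hDt]
    refine le_of_forall_gt fun N hN => ?_
    obtain ⟨N', hN', hN'N⟩ := exists_between hN
    refine lt_of_le_of_lt ?_ hN'N
    rw [ENNReal.div_le_iff (by simp [hD]) hDt, mul_comm]
    exact h N' hN' (hN'N.trans_le le_top).ne
  intro N hN hNt
  have hN0 : N ≠ 0 := (bot_le.trans_lt hN).ne'
  have hq' : ∀ U : Set (ℝ × ℝ), IsOpen U → 0 < volume U → volume U < ⊤ →
      ∫⁻ x, FU a U x ^ q ≤ N ^ q * volume U := fun U hU hU0 hUt =>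
    (volume_rpow_mul_rpow_le_iff hq hU0.ne' hUt.ne).1
      ((le_iSup (fun U : {U : Set (ℝ × ℝ) // IsOpen U ∧ 0 < volume U ∧ volume U < ⊤} =>
        (volume U.1) ^ (-(1/q)) * (∫⁻ x, (FU a U.1 x) ^ q ∂volume) ^ (1/q))
        ⟨U, hU, hU0, hUt⟩).trans hN.le)
  have hM := hFU a ((K + 1) * N) (mul_ne_zero (by simp) hN0) (by finiteness)
    fun s U hU hUt => (hmass a N hN0 hNt hq' s U hU hUt).trans (by
      gcongr
      exact le_self_add)
  refine iSup_le fun ⟨U, hU, hU0, hUt⟩ => ?_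
  refine (volume_rpow_mul_rpow_le_iff hp hU0.ne' hUt.ne).2 ?_
  refine (lintegral_FU_rpow_le_of_lt hp (lt_add_one p) a hU.measurableSet hU0 hUt
    (hM U hU hUt)).trans ?_
  rw [← mul_assoc]
  gcongr
  exact le_self_add

end
end
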